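/- arXiv:1703.10840 — 2 statements merged into one kernel-verified Lean document; each statement's English description precedes it below -/
import Mathlib

section
/- There exist three unrooted binary phylogenetic trees T1, T2, T3 on a common label set X with |X| ≥ 3 such that d_tw(T1,T3) > d_tw(T1,T2) + d_tw(T2,T3); in particular, the treewidth distance d_tw does not satisfy the triangle inequality. (A witness is given by trees with d_tw(T1,T2) = 1, d_tw(T2,T3) = 2 and d_tw(T1,T3) = 4.) -/
open SimpleGraph

/-- `G` has a tree decomposition of width at most `k`: a tree `t` together with
bags satisfying (tw1), (tw2) and (tw3), all of whose bags have size at most `k+1`. -/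
def HasTreeDecompWidthLE {V : Type*} (G : SimpleGraph V) (k : ℕ) : Prop :=
  ∃ (n : ℕ) (t : SimpleGraph (Fin (n + 1))) (bag : Fin (n + 1) → Finset V),
    t.IsTree ∧
    (∀ v : V, ∃ i, v ∈ bag i) ∧
    (∀ u v : V, G.Adj u v → ∃ i, u ∈ bag i ∧ v ∈ bag i) ∧
    (∀ v : V, (t.induce {i | v ∈ bag i}).Connected) ∧
    (∀ i, (bag i).card ≤ k + 1)

/-- The treewidth of a graph: the least `k` such that `G` has a tree decomposition
of width `k`. -/
noncomputable def treewidth {V : Type*} (G : SimpleGraph V) : ℕ :=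
  sInf {k | HasTreeDecompWidthLE G k}

/-- An unrooted binary phylogenetic graph (tree or network) on label set `X`:
a finite connected graph whose degree-1 vertices are bijectively labelled by `X`
and all of whose other vertices have degree 3. -/
structure PhyloGraph (V : Type*) (X : Type*) where
  graph : SimpleGraph V
  finite : Finite V
  connected : graph.Connected
  leaf : X → V
  leaf_inj : Function.Injective leaf
  leaf_deg : ∀ x : X, (graph.neighborSet (leaf x)).ncard = 1
  internal_deg : ∀ v : V, (∀ x : X, leaf x ≠ v) → (graph.neighborSet v).ncard = 3

/-- An unrooted binary phylogenetic tree on label set `X`. -/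
structure PhyloTree (V : Type*) (X : Type*) extends PhyloGraph V X where
  acyclic : graph.IsAcyclic

open Classical in
/-- The map identifying a leaf of the second graph with the leaf of the first
graph carrying the same label. -/
noncomputable def mergeMap {V1 V2 X : Type*} (l1 : X → V1) (l2 : X → V2) :
    V1 ⊕ V2 → V1 ⊕ V2
  | Sum.inl v => Sum.inl v
  | Sum.inr w => if h : ∃ x, l2 x = w then Sum.inl (l1 h.choose) else Sum.inr w

lemma mergeMap_idem {V1 V2 X : Type*} (l1 : X → V1) (l2 : X → V2) (u : V1 ⊕ V2) :
    mergeMap l1 l2 (mergeMap l1 l2 u) = mergeMap l1 l2 u := by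
  classical
  cases u with
  | inl v => rfl
  | inr w =>
    by_cases h : ∃ x, l2 x = w
    · simp [mergeMap, h]
    · simp [mergeMap, h]

/-- The vertex set of the display graph: the disjoint union of the vertex sets
of the two graphs, with leaves carrying the same label identified. -/
def DisplayVertex {V1 V2 X : Type*} (l1 : X → V1) (l2 : X → V2) : Type _ :=
  {u : V1 ⊕ V2 // mergeMap l1 l2 u = u}

/-- The canonical map from `V1 ⊕ V2` to the vertex set of the display graph. -/
noncomputable def toDisplay {V1 V2 X : Type*} (l1 : X → V1) (l2 : X → V2) (u : V1 ⊕ V2) :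
    DisplayVertex l1 l2 :=
  ⟨mergeMap l1 l2 u, mergeMap_idem l1 l2 u⟩

/-- The display graph of two leaf-labelled graphs: their disjoint union with the
leaves carrying the same label identified. -/
noncomputable def displayGraph {V1 V2 X : Type*} (G1 : SimpleGraph V1) (l1 : X → V1)
    (G2 : SimpleGraph V2) (l2 : X → V2) : SimpleGraph (DisplayVertex l1 l2) :=
  SimpleGraph.fromRel (fun a b =>
    (∃ u v : V1, G1.Adj u v ∧ a = toDisplay l1 l2 (Sum.inl u) ∧ b = toDisplay l1 l2 (Sum.inl v)) ∨
    (∃ u v : V2, G2.Adj u v ∧ a = toDisplay l1 l2 (Sum.inr u) ∧ b = toDisplay l1 l2 (Sum.inr v)))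

/-- The treewidth distance between two phylogenetic trees:
`d_tw(T1,T2) = tw(D(T1,T2)) - 2`. -/
noncomputable def dtw {V1 V2 X : Type*} (T1 : PhyloTree V1 X) (T2 : PhyloTree V2 X) : ℕ :=
  treewidth (displayGraph T1.graph T1.leaf T2.graph T2.leaf) - 2

/-- Two phylogenetic trees are compatible if there is a label-preserving
isomorphism between them. -/
def Compatible {V1 V2 X : Type*} (T1 : PhyloTree V1 X) (T2 : PhyloTree V2 X) : Prop :=
  ∃ φ : T1.graph ≃g T2.graph, ∀ x : X, φ (T1.leaf x) = T2.leaf x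

/-! ### Helly property for subtrees -/

section Helly

variable {N : Type*} {t : SimpleGraph N}

/-- Any two nodes of `S` are joined by a walk inside `S`. -/
def WalkConn (t : SimpleGraph N) (S : Set N) : Prop :=
  ∀ a ∈ S, ∀ b ∈ S, ∃ w : t.Walk a b, ∀ z ∈ w.support, z ∈ S

lemma walkConn_of_induce {S : Set N} (h : (t.induce S).Connected) : WalkConn t S := by
  intro a ha b hb
  have aux : ∀ {x y : S}, (t.induce S).Walk x y →
      ∃ w : t.Walk x.1 y.1, ∀ z ∈ w.support, z ∈ S := by
    intro x y w
    induction w with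
    | @nil u => exact ⟨Walk.nil, by simp⟩
    | @cons u v _ huv _ ih =>
      obtain ⟨w', hw'⟩ := ih
      have huv' : t.Adj u.1 v.1 := huv
      refine ⟨Walk.cons huv' w', ?_⟩
      intro z hz
      rw [Walk.support_cons, List.mem_cons] at hz
      rcases hz with rfl | hz
      · exact u.2
      · exact hw' z hz
  obtain ⟨w⟩ := h.preconnected ⟨a, ha⟩ ⟨b, hb⟩
  exact aux w

lemma path_to_root (ht : t.IsTree) {S : Set N} (hS : WalkConn t S) (r h x : N) (hh : h ∈ S)
    (hmin : ∀ y ∈ S, t.dist h r ≤ t.dist y r) (hx : x ∈ S) :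
    ∃ (q : t.Walk x h) (s : t.Walk h r), (∀ z ∈ q.support, z ∈ S) ∧
      (∀ v ∈ s.support, v ≠ h → t.dist v r < t.dist h r) ∧ (q.append s).IsPath := by
  classical
  obtain ⟨w, hw⟩ := hS x hx h hh
  obtain ⟨s, hs, hsl⟩ := ht.connected.exists_path_of_dist h r
  have key : ∀ v ∈ s.support, v ≠ h → t.dist v r < t.dist h r := by
    intro v hv hne
    have h1 := congrArg Walk.length (s.take_spec hv)
    rw [Walk.length_append] at h1
    have h2 := dist_le (s.dropUntil v hv)
    have h3 : (s.takeUntil v hv).length ≠ 0 := by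
      intro h0
      exact hne (Walk.eq_of_length_eq_zero h0).symm
    omega
  have hwS : ∀ z ∈ w.bypass.support, z ∈ S := fun z hz => hw z (w.support_bypass_subset_support hz)
  refine ⟨w.bypass, s, hwS, key, ?_⟩
  rw [Walk.isPath_def, Walk.support_append, List.nodup_append]
  refine ⟨w.bypass_isPath.support_nodup, hs.support_nodup.tail, ?_⟩
  intro a ha b hb hab
  subst hab
  have hb' : a ∈ s.support := List.mem_of_mem_tail hb
  have hne : a ≠ h := by
    rintro rfl
    have := hs.support_nodup
    rw [← Walk.cons_tail_support, List.nodup_cons] at this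
    exact this.1 hb
  have := key a hb' hne
  have := hmin a (hwS a ha)
  omega

lemma helly {m : ℕ} (ht : t.IsTree) (S : Fin (m + 1) → Set N) (hS : ∀ j, WalkConn t (S j))
    (hp : ∀ i j, (S i ∩ S j).Nonempty) : ∃ c, ∀ j, c ∈ S j := by
  classical
  have hne : ∀ j, (S j).Nonempty := fun j => by simpa using hp j j
  obtain ⟨r, -⟩ := hne 0
  have htop : ∀ j, ∃ h ∈ S j, ∀ y ∈ S j, t.dist h r ≤ t.dist y r := by
    intro j
    obtain ⟨h, hh, hm⟩ := WellFounded.has_min (measure (fun y => t.dist y r)).wf (S j) (hne j)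
    exact ⟨h, hh, fun y hy => not_lt.1 (hm y hy)⟩
  choose h hh hmin using htop
  obtain ⟨j, -, hj⟩ := Finset.exists_max_image Finset.univ (fun j => t.dist (h j) r)
    ⟨0, Finset.mem_univ _⟩
  refine ⟨h j, fun i => ?_⟩
  obtain ⟨x, hxi, hxj⟩ := hp i j
  obtain ⟨qi, si, hqi, hsi, hpi⟩ := path_to_root ht (hS i) r (h i) x (hh i) (hmin i) hxi
  obtain ⟨qj, sj, hqj, hsj, hpj⟩ := path_to_root ht (hS j) r (h j) x (hh j) (hmin j) hxj
  have heq : qi.append si = qj.append sj :=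
    congrArg Subtype.val ((ht.isAcyclic.subsingleton_path _ _).elim ⟨_, hpi⟩ ⟨_, hpj⟩)
  have hmem : h j ∈ (qi.append si).support := by
    rw [heq, Walk.mem_support_append_iff]
    exact Or.inl qj.end_mem_support
  rw [Walk.mem_support_append_iff] at hmem
  rcases hmem with hm | hm
  · exact hqi _ hm
  · by_cases he : h j = h i
    · rw [he]; exact hh i
    · have h1 := hsi _ hm he
      have h2 := hj i (Finset.mem_univ _)
      omega

end Helly

/-! ### Lower bound from clique minors -/

lemma le_width_of_minor {V : Type*} {G : SimpleGraph V} {m : ℕ}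
    (branch : V → Fin (m + 1)) (step : V → V) (level : V → ℕ) (root : Fin (m + 1) → V)
    (hroot : ∀ j, branch (root j) = j)
    (hstep : ∀ v, v = root (branch v) ∨
      (G.Adj v (step v) ∧ branch (step v) = branch v ∧ level (step v) < level v))
    (htouch : ∀ i j, i ≠ j → ∃ u v, branch u = i ∧ branch v = j ∧ G.Adj u v)
    {k : ℕ} (hk : HasTreeDecompWidthLE G k) : m ≤ k := by
  classical
  obtain ⟨n, t, bag, ht, hcov, hedge, hconn, hcard⟩ := hk
  let S : Fin (m + 1) → Set (Fin (n + 1)) := fun j => {i | ∃ v, branch v = j ∧ v ∈ bag i}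
  have hin : ∀ v, ∀ a ∈ {i | v ∈ bag i}, ∀ b ∈ {i | v ∈ bag i},
      ∃ w : t.Walk a b, ∀ z ∈ w.support, z ∈ S (branch v) := by
    intro v a ha b hb
    obtain ⟨w, hw⟩ := walkConn_of_induce (hconn v) a ha b hb
    exact ⟨w, fun z hz => ⟨v, rfl, hw z hz⟩⟩
  choose c hc using fun j => hcov (root j)
  have hto : ∀ l v, level v ≤ l → ∀ a, v ∈ bag a →
      ∃ w : t.Walk a (c (branch v)), ∀ z ∈ w.support, z ∈ S (branch v) := by
    intro l
    induction l with
    | zero =>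
      intro v hl a ha
      rcases hstep v with h | ⟨_, _, h⟩
      · refine hin v a ha _ ?_
        have := hc (branch v)
        rw [← h] at this
        exact this
      · omega
    | succ l ih =>
      intro v hl a ha
      rcases hstep v with h | ⟨h1, h2, h3⟩
      · refine hin v a ha _ ?_
        have := hc (branch v)
        rw [← h] at this
        exact this
      · obtain ⟨i, hi1, hi2⟩ := hedge _ _ h1
        obtain ⟨w1, hw1⟩ := hin v a ha i hi1
        have h4 := ih (step v) (by omega) i hi2
        rw [h2] at h4
        obtain ⟨w2, hw2⟩ := h4
        refine ⟨w1.append w2, fun z hz => ?_⟩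
        rw [Walk.mem_support_append_iff] at hz
        exact hz.elim (hw1 z) (hw2 z)
  have hS : ∀ j, WalkConn t (S j) := by
    rintro j a ⟨u, rfl, ha⟩ b ⟨v, hv, hb⟩
    obtain ⟨w1, hw1⟩ := hto _ u le_rfl a ha
    have h4 := hto _ v le_rfl b hb
    rw [hv] at h4
    obtain ⟨w2, hw2⟩ := h4
    refine ⟨w1.append w2.reverse, fun z hz => ?_⟩
    rw [Walk.mem_support_append_iff, Walk.support_reverse, List.mem_reverse] at hz
    exact hz.elim (hw1 z) (hw2 z)
  have hp : ∀ i j, (S i ∩ S j).Nonempty := by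
    intro i j
    by_cases hij : i = j
    · subst hij
      exact ⟨c i, ⟨root i, hroot i, hc i⟩, ⟨root i, hroot i, hc i⟩⟩
    · obtain ⟨u, v, hu, hv, huv⟩ := htouch i j hij
      obtain ⟨a, ha, hb⟩ := hedge _ _ huv
      exact ⟨a, ⟨u, hu, ha⟩, ⟨v, hv, hb⟩⟩
  obtain ⟨a, ha⟩ := helly ht S hS hp
  choose f hf1 hf2 using ha
  have hinj : Function.Injective f := by
    intro i j hij
    rw [← hf1 i, ← hf1 j, hij]
  have h1 : (Finset.univ.image f).card ≤ (bag a).card := by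
    apply Finset.card_le_card
    intro v hv
    obtain ⟨j, -, rfl⟩ := Finset.mem_image.1 hv
    exact hf2 j
  rw [Finset.card_image_of_injective _ hinj, Finset.card_univ, Fintype.card_fin] at h1
  have := hcard a
  omega

/-! ### Trees given by parent functions -/

/-- The graph on `Fin (n+1)` joining every `i ≠ last` to its parent `par i`. -/
def parGraph {n : ℕ} (par : Fin (n + 1) → Fin (n + 1)) : SimpleGraph (Fin (n + 1)) where
  Adj i j := i ≠ j ∧ ((i ≠ Fin.last n ∧ par i = j) ∨ (j ≠ Fin.last n ∧ par j = i))
  symm := ⟨fun _ _ h => ⟨h.1.symm, h.2.symm⟩⟩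
  loopless := ⟨fun _ h => h.1 rfl⟩

instance {n : ℕ} (par : Fin (n + 1) → Fin (n + 1)) : DecidableRel (parGraph par).Adj :=
  fun i j => inferInstanceAs
    (Decidable (i ≠ j ∧ ((i ≠ Fin.last n ∧ par i = j) ∨ (j ≠ Fin.last n ∧ par j = i))))

lemma parGraph_adj {n : ℕ} {par : Fin (n + 1) → Fin (n + 1)}
    (h : ∀ i, i ≠ Fin.last n → i < par i) {i : Fin (n + 1)} (hi : i ≠ Fin.last n) :
    (parGraph par).Adj i (par i) :=
  ⟨(h i hi).ne, Or.inl ⟨hi, rfl⟩⟩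

lemma parGraph_isTree {n : ℕ} {par : Fin (n + 1) → Fin (n + 1)}
    (h : ∀ i, i ≠ Fin.last n → i < par i) : (parGraph par).IsTree := by
  classical
  have hreach : ∀ (l : ℕ) (i : Fin (n + 1)), n - i.val ≤ l →
      (parGraph par).Reachable i (Fin.last n) := by
    intro l
    induction l with
    | zero =>
      intro i hi
      have : i = Fin.last n := by
        apply Fin.ext
        have := i.2
        simp only [Fin.val_last]
        omega
      rw [this]
    | succ l ih =>
      intro i hi
      by_cases hl : i = Fin.last n
      · rw [hl]
      · have h1 := h i hl
        have h2 : i.val < (par i).val := h1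
        exact (parGraph_adj h hl).reachable.trans (ih (par i) (by omega))
  have hc : (parGraph par).Connected :=
    { preconnected := fun a b => (hreach _ a le_rfl).trans (hreach _ b le_rfl).symm
      nonempty := ⟨0⟩ }
  rw [isTree_iff_connected_and_card]
  refine ⟨hc, le_antisymm ?_ hc.card_vert_le_card_edgeSet_add_one⟩
  have hsub : (parGraph par).edgeSet ⊆
      (((Finset.univ.erase (Fin.last n)).image (fun i => s(i, par i)) : Finset _) : Set _) := by
    intro e
    induction e using Sym2.ind with
    | _ a b =>
      intro he
      rw [mem_edgeSet] at he
      rw [Finset.coe_image]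
      rcases he.2 with ⟨ha, hb⟩ | ⟨ha, hb⟩
      · exact ⟨a, by simp [ha], by simp [hb]⟩
      · exact ⟨b, by simp [ha], by simp [hb, Sym2.eq_swap]⟩
  have h1 := Set.ncard_le_ncard hsub (Finset.finite_toSet _)
  rw [Set.ncard_coe_finset] at h1
  have h2 := Finset.card_image_le (s := Finset.univ.erase (Fin.last n))
    (f := fun i => s(i, par i))
  rw [Finset.card_erase_of_mem (Finset.mem_univ _), Finset.card_univ, Fintype.card_fin] at h2
  rw [Nat.card_coe_set_eq, Nat.card_eq_fintype_card, Fintype.card_fin]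
  omega

/-! ### Upper bound from explicit elimination orders -/

lemma hasTD_of_data {V : Type*} {G : SimpleGraph V} [DecidableEq V] {n k : ℕ}
    (own : V → Fin (n + 1)) (bag : Fin (n + 1) → List V) (up : Fin (n + 1) → Fin (n + 1))
    (hup : ∀ i, i ≠ Fin.last n → i < up i)
    (hown : ∀ v, v ∈ bag (own v))
    (hstep : ∀ i, ∀ v ∈ bag i, i = own v ∨ (i ≠ Fin.last n ∧ v ∈ bag (up i)))
    (hedge : ∀ u v, G.Adj u v → v ∈ bag (own u) ∨ u ∈ bag (own v))
    (hlen : ∀ i, (bag i).length ≤ k + 1) : HasTreeDecompWidthLE G k := by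
  refine ⟨n, parGraph up, fun i => (bag i).toFinset, parGraph_isTree hup, ?_, ?_, ?_, ?_⟩
  · intro v
    exact ⟨own v, by simpa using hown v⟩
  · intro u v huv
    rcases hedge u v huv with h | h
    · exact ⟨own u, by simpa using hown u, by simpa using h⟩
    · exact ⟨own v, by simpa using h, by simpa using hown v⟩
  · intro v
    have hv : own v ∈ {i | v ∈ (bag i).toFinset} := by simpa using hown v
    have hreach : ∀ (l : ℕ) (i : Fin (n + 1)) (hi : i ∈ {i | v ∈ (bag i).toFinset}),
        n - i.val ≤ l → ((parGraph up).induce {i | v ∈ (bag i).toFinset}).Reachable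
          ⟨i, hi⟩ ⟨own v, hv⟩ := by
      intro l
      induction l with
      | zero =>
        intro i hi hl
        rcases hstep i v (by simpa using hi) with h | ⟨h, _⟩
        · subst h; exact Reachable.refl _
        · exfalso
          apply h
          apply Fin.ext
          have := i.2
          simp only [Fin.val_last]
          omega
      | succ l ih =>
        intro i hi hl
        rcases hstep i v (by simpa using hi) with h | ⟨h, h'⟩
        · subst h; exact Reachable.refl _
        · have h2 : i.val < (up i).val := hup i h
          have hm : up i ∈ {i | v ∈ (bag i).toFinset} := by simpa using h'
          refine Reachable.trans (Adj.reachable ?_) (ih (up i) hm (by omega))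
          exact parGraph_adj hup h
    exact
      { preconnected := fun a b => (hreach _ a.1 a.2 le_rfl).trans (hreach _ b.1 b.2 le_rfl).symm
        nonempty := ⟨⟨own v, hv⟩⟩ }
  · intro i
    exact (List.toFinset_card_le _).trans (hlen i)

/-- Tree decompositions can be transported along isomorphisms. -/
lemma hasTD_iso {V W : Type*} {G : SimpleGraph V} {H : SimpleGraph W} (e : G ≃g H) {k : ℕ}
    (h : HasTreeDecompWidthLE G k) : HasTreeDecompWidthLE H k := by
  obtain ⟨n, t, bag, ht, hcov, hedge, hconn, hcard⟩ := h
  have hmem : ∀ v i, v ∈ (bag i).map e.toEquiv.toEmbedding ↔ e.symm v ∈ bag i := by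
    intro v i
    rw [Finset.mem_map_equiv]
    rfl
  refine ⟨n, t, fun i => (bag i).map e.toEquiv.toEmbedding, ht, ?_, ?_, ?_, ?_⟩
  · intro v
    obtain ⟨i, hi⟩ := hcov (e.symm v)
    exact ⟨i, (hmem v i).2 hi⟩
  · intro u v huv
    obtain ⟨i, hi, hj⟩ := hedge _ _ ((e.symm.map_adj_iff).2 huv)
    exact ⟨i, (hmem u i).2 hi, (hmem v i).2 hj⟩
  · intro v
    have hs : {i | v ∈ (bag i).map e.toEquiv.toEmbedding} = {i | e.symm v ∈ bag i} := by
      ext i; exact hmem v i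
    rw [hs]
    exact hconn _
  · intro i
    rw [Finset.card_map]
    exact hcard i

lemma treewidth_iso {V W : Type*} {G : SimpleGraph V} {H : SimpleGraph W} (e : G ≃g H) :
    treewidth G = treewidth H := by
  unfold treewidth
  congr 1
  ext k
  exact ⟨hasTD_iso e, hasTD_iso e.symm⟩

lemma treewidth_eq {V : Type*} {G : SimpleGraph V} {k : ℕ} (h : HasTreeDecompWidthLE G k)
    (h' : ∀ m, HasTreeDecompWidthLE G m → k ≤ m) : treewidth G = k :=
  le_antisymm (Nat.sInf_le h) (le_csInf ⟨k, h⟩ h')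

/-! ### Phylogenetic trees on 18 leaves and a concrete model of their display graphs -/

/-- Leaf `x` is the vertex `x`. -/
def leafMap : Fin 18 → Fin 34 := Fin.castLE (by decide)

/-- The phylogenetic tree given by a parent function. -/
def mkTree (p : Fin 34 → Fin 34) (hp : ∀ i, i ≠ Fin.last 33 → i < p i)
    (h1 : ∀ x : Fin 18, (parGraph (n := 33) p).degree (leafMap x) = 1)
    (h3 : ∀ v : Fin 34, 18 ≤ v.val → (parGraph (n := 33) p).degree v = 3) :
    PhyloTree (Fin 34) (Fin 18) where
  graph := parGraph (n := 33) p
  finite := inferInstance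
  connected := (parGraph_isTree hp).connected
  leaf := leafMap
  leaf_inj := Fin.castLE_injective _
  leaf_deg := by
    intro x
    rw [Set.ncard_eq_toFinset_card']
    exact h1 x
  internal_deg := by
    intro v hv
    rw [Set.ncard_eq_toFinset_card']
    refine h3 v ?_
    by_contra hlt
    exact hv ⟨v.val, by omega⟩ (Fin.ext rfl)
  acyclic := (parGraph_isTree hp).isAcyclic

/-- Vertices of the first tree inside the model. -/
def codeL (v : Fin 34) : Fin 50 := ⟨v.val, by omega⟩

/-- Vertices of the second tree inside the model. -/
def codeR (w : Fin 34) : Fin 50 := if w.val < 18 then ⟨w.val, by omega⟩ else ⟨w.val + 16, by omega⟩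

/-- Concrete model of the display graph. -/
def model (p q : Fin 34 → Fin 34) : SimpleGraph (Fin 50) :=
  SimpleGraph.fromRel (fun a b =>
    (∃ u v : Fin 34, (parGraph (n := 33) p).Adj u v ∧ a = codeL u ∧ b = codeL v) ∨
    (∃ u v : Fin 34, (parGraph (n := 33) q).Adj u v ∧ a = codeR u ∧ b = codeR v))

/-- The vertex of the display graph with a given code. -/
noncomputable def decode (i : Fin 50) : DisplayVertex leafMap leafMap :=
  if h : i.val < 34 then toDisplay leafMap leafMap (Sum.inl ⟨i.val, h⟩)
  else toDisplay leafMap leafMap (Sum.inr ⟨i.val - 16, by omega⟩)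

lemma not_leaf {w : Fin 34} (hw : ¬ w.val < 18) : ¬ ∃ x, leafMap x = w := by
  rintro ⟨x, rfl⟩
  exact hw x.2

lemma merge_inr_nonleaf {w : Fin 34} (hw : ¬ w.val < 18) :
    mergeMap leafMap leafMap (Sum.inr w) = Sum.inr w := by
  simp only [mergeMap, dif_neg (not_leaf hw)]

lemma merge_inr_leaf {w : Fin 34} (hw : w.val < 18) :
    mergeMap leafMap leafMap (Sum.inr w) = Sum.inl w := by
  have h : ∃ x, leafMap x = w := ⟨⟨w.val, hw⟩, rfl⟩
  simp only [mergeMap, dif_pos h, h.choose_spec]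

lemma toDisplay_inl (v : Fin 34) : toDisplay leafMap leafMap (Sum.inl v) = decode (codeL v) := by
  have : (codeL v).val < 34 := v.2
  rw [decode, dif_pos this]
  rfl

lemma toDisplay_inr (w : Fin 34) : toDisplay leafMap leafMap (Sum.inr w) = decode (codeR w) := by
  by_cases hw : w.val < 18
  · have h1 : codeR w = codeL w := by simp [codeR, codeL, hw]
    rw [h1, ← toDisplay_inl]
    apply Subtype.ext
    exact merge_inr_leaf hw
  · have h1 : (codeR w).val = w.val + 16 := by simp [codeR, hw]
    have h2 : ¬ (codeR w).val < 34 := by omega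
    rw [decode, dif_neg h2]
    congr 2
    apply Fin.ext
    simp [h1]

lemma decode_bijective : Function.Bijective decode := by
  constructor
  · intro i j hij
    have hv := congrArg Subtype.val hij
    have hval : ∀ i : Fin 50, (decode i).val = if h : i.val < 34 then Sum.inl ⟨i.val, h⟩
        else Sum.inr ⟨i.val - 16, by omega⟩ := by
      intro i
      unfold decode
      split_ifs with h
      · rfl
      · exact merge_inr_nonleaf (by simp; omega)
    rw [hval, hval] at hv
    apply Fin.ext
    split_ifs at hv with h1 h2 h2
    · simpa using hv
    · simp at hv
      omega
  · rintro ⟨u, hu⟩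
    cases u with
    | inl v =>
      refine ⟨codeL v, ?_⟩
      rw [← toDisplay_inl]
      exact Subtype.ext hu
    | inr w =>
      refine ⟨codeR w, ?_⟩
      rw [← toDisplay_inr]
      exact Subtype.ext hu

/-- The display graph is isomorphic to the model. -/
noncomputable def modelIso (p q : Fin 34 → Fin 34) : model p q ≃g
    displayGraph (V1 := Fin 34) (V2 := Fin 34) (parGraph (n := 33) p) leafMap (parGraph (n := 33) q) leafMap where
  toEquiv := Equiv.ofBijective decode decode_bijective
  map_rel_iff' := by
    intro a b
    simp only [Equiv.ofBijective_apply, displayGraph, model, fromRel_adj, toDisplay_inl,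
      toDisplay_inr, decode_bijective.injective.eq_iff, ne_eq]

/-- Computable description of the edges of the model. -/
def edgeB (p q : Fin 34 → Fin 34) (a b : Fin 50) : Prop :=
  ∃ v : Fin 34, v ≠ Fin.last 33 ∧
    ((codeL v = a ∧ codeL (p v) = b) ∨ (codeR v = a ∧ codeR (q v) = b))

instance (p q : Fin 34 → Fin 34) (a b : Fin 50) : Decidable (edgeB p q a b) := by
  unfold edgeB; infer_instance

lemma model_adj {p q : Fin 34 → Fin 34} (hp : ∀ i, i ≠ Fin.last 33 → i < p i)
    (hq : ∀ i, i ≠ Fin.last 33 → i < q i) (a b : Fin 50) :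
    (model p q).Adj a b ↔ edgeB p q a b ∨ edgeB p q b a := by
  have hR : ∀ u v : Fin 34, u < v → codeR u ≠ codeR v := by
    intro u v huv h
    have h0 : u.val < v.val := huv
    have := congrArg Fin.val h
    unfold codeR at this
    split_ifs at this <;> simp at this <;> omega
  have hL : ∀ u v : Fin 34, u < v → codeL u ≠ codeL v := by
    intro u v huv h
    have h0 : u.val < v.val := huv
    have h1 : (codeL u).val = (codeL v).val := by rw [h]
    have : u.val = v.val := h1
    omega
  constructor
  · rintro ⟨-, h⟩
    rcases h with (⟨u, v, ⟨-, h | h⟩, rfl, rfl⟩ | ⟨u, v, ⟨-, h | h⟩, rfl, rfl⟩) |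
      (⟨u, v, ⟨-, h | h⟩, rfl, rfl⟩ | ⟨u, v, ⟨-, h | h⟩, rfl, rfl⟩)
    · exact Or.inl ⟨u, h.1, Or.inl ⟨rfl, by rw [h.2]⟩⟩
    · exact Or.inr ⟨v, h.1, Or.inl ⟨rfl, by rw [h.2]⟩⟩
    · exact Or.inl ⟨u, h.1, Or.inr ⟨rfl, by rw [h.2]⟩⟩
    · exact Or.inr ⟨v, h.1, Or.inr ⟨rfl, by rw [h.2]⟩⟩
    · exact Or.inr ⟨u, h.1, Or.inl ⟨rfl, by rw [h.2]⟩⟩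
    · exact Or.inl ⟨v, h.1, Or.inl ⟨rfl, by rw [h.2]⟩⟩
    · exact Or.inr ⟨u, h.1, Or.inr ⟨rfl, by rw [h.2]⟩⟩
    · exact Or.inl ⟨v, h.1, Or.inr ⟨rfl, by rw [h.2]⟩⟩
  · have aux : ∀ a b, edgeB p q a b → (model p q).Adj a b := by
      rintro a b ⟨v, hv, ⟨rfl, rfl⟩ | ⟨rfl, rfl⟩⟩
      · exact ⟨hL _ _ (hp v hv), Or.inl (Or.inl ⟨v, p v, parGraph_adj hp hv, rfl, rfl⟩)⟩
      · exact ⟨hR _ _ (hq v hv), Or.inl (Or.inr ⟨v, q v, parGraph_adj hq hv, rfl, rfl⟩)⟩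
    rintro (h | h)
    · exact aux a b h
    · exact (aux b a h).symm

/-- Certified computation of the treewidth of the model. -/
lemma treewidth_model {p q : Fin 34 → Fin 34} (hp : ∀ i, i ≠ Fin.last 33 → i < p i)
    (hq : ∀ i, i ≠ Fin.last 33 → i < q i) {k : ℕ}
    (own : Fin 50 → Fin 50) (bag : Fin 50 → List (Fin 50)) (up : Fin 50 → Fin 50)
    (branch : Fin 50 → Fin (k + 1)) (step : Fin 50 → Fin 50) (level : Fin 50 → ℕ)
    (root : Fin (k + 1) → Fin 50)
    (hup : ∀ i, i ≠ Fin.last 49 → i < up i)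
    (hown : ∀ v, v ∈ bag (own v))
    (hbag : ∀ i, ∀ v ∈ bag i, i = own v ∨ (i ≠ Fin.last 49 ∧ v ∈ bag (up i)))
    (hedge : ∀ v : Fin 34, v ≠ Fin.last 33 →
      (codeL v ∈ bag (own (codeL (p v))) ∨ codeL (p v) ∈ bag (own (codeL v))) ∧
      (codeR v ∈ bag (own (codeR (q v))) ∨ codeR (q v) ∈ bag (own (codeR v))))
    (hlen : ∀ i, (bag i).length ≤ k + 1)
    (hroot : ∀ j, branch (root j) = j)
    (hstep : ∀ v, v = root (branch v) ∨
      ((edgeB p q v (step v) ∨ edgeB p q (step v) v) ∧ branch (step v) = branch v ∧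
        level (step v) < level v))
    (htouch : ∀ i j, i < j → ∃ v : Fin 34, v ≠ Fin.last 33 ∧
      ((branch (codeL v) = i ∧ branch (codeL (p v)) = j) ∨
       (branch (codeL v) = j ∧ branch (codeL (p v)) = i) ∨
       (branch (codeR v) = i ∧ branch (codeR (q v)) = j) ∨
       (branch (codeR v) = j ∧ branch (codeR (q v)) = i))) :
    treewidth (model p q) = k := by
  apply treewidth_eq
  · have aux : ∀ u v, edgeB p q u v → u ∈ bag (own v) ∨ v ∈ bag (own u) := by
      rintro _ _ ⟨w, hw, ⟨rfl, rfl⟩ | ⟨rfl, rfl⟩⟩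
      · exact (hedge w hw).1
      · exact (hedge w hw).2
    refine hasTD_of_data (n := 49) own bag up hup hown hbag ?_ hlen
    intro u v huv
    rcases (model_adj hp hq u v).1 huv with h | h
    · exact (aux u v h).symm
    · exact aux v u h
  · intro m hm
    have ht : ∀ i j, i < j → ∃ u v, branch u = i ∧ branch v = j ∧ (model p q).Adj u v := by
      intro i j hij
      obtain ⟨v, hv, h⟩ := htouch i j hij
      have e1 : (model p q).Adj (codeL v) (codeL (p v)) :=
        (model_adj hp hq _ _).2 (Or.inl ⟨v, hv, Or.inl ⟨rfl, rfl⟩⟩)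
      have e2 : (model p q).Adj (codeR v) (codeR (q v)) :=
        (model_adj hp hq _ _).2 (Or.inl ⟨v, hv, Or.inr ⟨rfl, rfl⟩⟩)
      rcases h with h | h | h | h
      · exact ⟨_, _, h.1, h.2, e1⟩
      · exact ⟨_, _, h.2, h.1, e1.symm⟩
      · exact ⟨_, _, h.1, h.2, e2⟩
      · exact ⟨_, _, h.2, h.1, e2.symm⟩
    refine le_width_of_minor (G := model p q) branch step level root hroot ?_ ?_ hm
    · intro v
      rcases hstep v with h | ⟨h1, h2⟩
      · exact Or.inl h
      · exact Or.inr ⟨(model_adj hp hq _ _).2 h1, h2⟩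
    · intro i j hij
      rcases lt_or_gt_of_ne hij with h | h
      · exact ht i j h
      · obtain ⟨u, v, hu, hv, huv⟩ := ht j i h
        exact ⟨v, u, hv, hu, huv.symm⟩

/-! ### The data: three trees, elimination orders and clique minors -/

def par1 : Fin 34 → Fin 34 :=
  ![25, 26, 33, 19, 29, 31, 25, 33, 18, 22, 22, 27, 26, 19, 24, 23, 21, 18, 20, 20, 21, 23, 24, 27, 28, 28, 29, 30, 30, 31, 32, 32, 33, 33]

def par2 : Fin 34 → Fin 34 :=
  ![24, 22, 33, 28, 32, 20, 24, 31, 19, 26, 27, 23, 20, 30, 23, 18, 18, 21, 19, 21, 22, 25, 25, 26, 27, 28, 29, 29, 30, 31, 32, 33, 33, 33]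

def par3 : Fin 34 → Fin 34 :=
  ![25, 20, 26, 33, 23, 18, 28, 24, 18, 24, 30, 22, 33, 26, 22, 19, 21, 29, 19, 20, 21, 23, 25, 27, 27, 28, 29, 30, 31, 31, 32, 32, 33, 33]

def own12 : Fin 50 → Fin 50 :=
  ![1, 18, 17, 3, 4, 14, 2, 16, 13, 12, 6, 7, 19, 10, 5, 8, 0, 11, 23, 34, 36, 31, 47, 33,
    42, 9, 21, 40, 48, 26, 41, 24, 39, 27, 30, 32, 22, 35, 28, 46, 15, 37, 45, 43, 29, 49,
    25, 44, 38, 20]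

def bag12 : Fin 50 → List (Fin 50) :=
  ![[16, 21, 34], [0, 25, 40], [6, 25, 40], [3, 19, 44], [4, 29, 48], [14, 24, 39],
    [10, 22, 43], [11, 27, 39], [15, 23, 34], [25, 28, 40], [13, 19, 46], [17, 18, 37],
    [9, 22, 42], [8, 18, 35], [5, 31, 36], [40, 28, 43], [7, 33, 47], [2, 33, 49],
    [1, 26, 38], [12, 26, 36], [49, 33, 47, 48], [26, 29, 36, 38], [36, 29, 31, 38],
    [18, 20, 35, 37], [31, 29, 32, 38], [46, 19, 44, 48], [29, 32, 38, 48], [33, 32, 47, 48],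
    [38, 32, 41, 48], [44, 19, 41, 48], [34, 21, 23, 35], [21, 20, 23, 35], [35, 20, 23, 37],
    [23, 20, 27, 37], [19, 20, 41, 48], [37, 20, 27, 41], [20, 27, 41, 48], [41, 27, 32, 48],
    [48, 27, 32, 47], [32, 27, 30, 47], [27, 30, 39, 47], [30, 28, 39, 47], [24, 22, 28, 39],
    [43, 22, 28, 45], [47, 28, 39, 45], [42, 22, 39, 45], [39, 22, 28, 45], [22, 28, 45],
    [28, 45], [45]]

def up12 : Fin 50 → Fin 50 :=
  ![30, 9, 9, 29, 26, 42, 43, 40, 30, 15, 25, 23, 45, 23, 22, 43, 27, 20, 21, 21, 27, 22, 24,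
    32, 26, 29, 28, 38, 37, 34, 31, 32, 33, 35, 36, 36, 37, 38, 39, 40, 41, 44, 46, 47, 46,
    46, 47, 48, 49, 49]

def branch12 : Fin 50 → Fin 4 :=
  ![3, 2, 1, 0, 2, 2, 3, 1, 2, 1, 3, 3, 2, 0, 1, 3, 0, 0, 0, 0, 0, 0, 3, 3, 1, 3, 2, 3, 3, 2,
    3, 2, 3, 1, 2, 2, 2, 2, 2, 1, 3, 2, 1, 3, 2, 1, 0, 1, 1, 1]

def step12 : Fin 50 → Fin 50 :=
  ![0, 1, 2, 3, 29, 36, 25, 33, 35, 42, 43, 27, 26, 19, 39, 23, 21, 18, 20, 3, 19, 20, 10,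
    27, 14, 0, 1, 30, 25, 26, 28, 29, 30, 2, 35, 37, 38, 41, 1, 42, 0, 38, 45, 40, 41, 47,
    13, 49, 49, 2]

def level12 : Fin 50 → ℕ :=
  ![0, 0, 0, 0, 3, 3, 2, 2, 5, 5, 3, 5, 2, 2, 6, 6, 4, 4, 3, 1, 2, 3, 4, 5, 7, 1, 1, 4, 2, 2,
    3, 3, 4, 1, 5, 4, 2, 3, 1, 5, 1, 2, 4, 2, 3, 3, 3, 2, 2, 1]

def root12 : Fin 4 → Fin 50 :=
  ![3, 2, 1, 0]

def own23 : Fin 50 → Fin 50 :=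
  ![19, 7, 2, 18, 9, 8, 11, 16, 10, 5, 15, 4, 1, 0, 6, 13, 3, 14, 29, 32, 35, 40, 33, 17, 20,
    27, 37, 38, 49, 23, 25, 44, 43, 26, 30, 31, 28, 46, 12, 48, 24, 22, 41, 42, 21, 45, 36,
    39, 47, 34]

def bag23 : Fin 50 → List (Fin 50) :=
  ![[13, 30, 42], [12, 20, 49], [2, 33, 42], [16, 18, 37], [11, 23, 38], [9, 26, 40],
    [14, 23, 38], [1, 22, 36], [5, 20, 34], [4, 32, 39], [8, 19, 34], [6, 24, 44],
    [38, 23, 41], [15, 18, 35], [17, 21, 45], [10, 27, 46], [7, 31, 40], [23, 26, 41],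
    [3, 28, 49], [0, 24, 41], [24, 27, 41, 44], [44, 27, 41, 47], [41, 26, 27, 47],
    [29, 26, 27, 31], [40, 26, 31, 43], [30, 28, 32, 42], [33, 31, 32, 42], [25, 21, 22, 28],
    [36, 22, 35, 37], [18, 19, 35, 37], [34, 19, 20, 35], [35, 19, 20, 22, 37],
    [19, 20, 21, 22, 37], [22, 20, 21, 28, 37], [49, 20, 28, 48], [20, 21, 28, 37, 48],
    [46, 27, 43, 48], [26, 27, 31, 43, 47], [27, 31, 43, 47, 48], [47, 31, 43, 45, 48],
    [21, 28, 37, 45, 48], [42, 28, 31, 32, 45], [43, 31, 39, 45, 48], [32, 28, 31, 39, 45],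
    [31, 28, 39, 45, 48], [45, 28, 37, 39, 48], [37, 28, 39, 48], [48, 28, 39], [39, 28],
    [28]]

def up23 : Fin 50 → Fin 50 :=
  ![25, 34, 26, 29, 12, 24, 12, 28, 30, 43, 30, 20, 17, 29, 40, 36, 24, 22, 34, 20, 21, 22,
    37, 37, 37, 41, 41, 33, 31, 31, 31, 32, 33, 35, 35, 40, 38, 38, 39, 42, 45, 43, 44, 44,
    45, 46, 47, 48, 49, 49]

def branch23 : Fin 50 → Fin 5 :=
  ![2, 1, 3, 1, 3, 2, 2, 3, 0, 3, 3, 2, 2, 2, 3, 0, 0, 1, 0, 0, 2, 1, 1, 3, 3, 1, 3, 3, 1, 3,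
    3, 3, 3, 3, 2, 4, 4, 3, 2, 3, 3, 2, 2, 2, 2, 2, 2, 2, 2, 2]

def step23 : Fin 50 → Fin 50 :=
  ![0, 1, 2, 28, 32, 20, 44, 31, 8, 40, 27, 38, 49, 42, 23, 18, 18, 21, 19, 8, 12, 25, 1, 26,
    27, 22, 29, 29, 25, 31, 32, 33, 33, 2, 5, 35, 35, 39, 41, 4, 7, 0, 45, 46, 41, 47, 48,
    44, 47, 48]

def level23 : Fin 50 → ℕ :=
  ![0, 0, 0, 4, 3, 8, 3, 3, 0, 5, 5, 3, 6, 6, 6, 3, 3, 4, 2, 1, 7, 3, 1, 5, 5, 2, 4, 4, 3, 3,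
    3, 2, 2, 1, 9, 0, 1, 5, 2, 4, 4, 1, 5, 6, 2, 4, 5, 3, 4, 5]

def root23 : Fin 5 → Fin 50 :=
  ![8, 1, 0, 2, 35]

def own13 : Fin 50 → Fin 50 :=
  ![10, 11, 8, 5, 9, 14, 16, 1, 7, 3, 0, 13, 12, 17, 2, 4, 15, 6, 45, 41, 37, 26, 42, 46, 21,
    20, 40, 33, 32, 36, 28, 24, 48, 34, 38, 29, 35, 39, 31, 30, 23, 19, 44, 43, 18, 27, 22,
    47, 49, 25]

def bag13 : Fin 50 → List (Fin 50) :=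
  ![[10, 22, 46], [7, 33, 40], [14, 24, 38], [9, 22, 40], [15, 23, 35], [3, 19, 49],
    [17, 18, 45], [8, 18, 34], [2, 33, 42], [4, 29, 39], [0, 25, 41], [1, 26, 36],
    [12, 26, 49], [11, 27, 38], [5, 31, 34], [16, 21, 37], [6, 25, 44], [13, 19, 42],
    [44, 25, 41, 47], [41, 25, 38, 47], [25, 28, 38, 47], [24, 22, 28, 38], [46, 22, 43, 48],
    [40, 22, 33, 43], [31, 29, 32, 34], [49, 19, 26, 48], [21, 20, 23, 37], [45, 18, 42, 47],
    [30, 27, 28, 32], [35, 23, 34, 36], [39, 29, 37, 43], [38, 22, 27, 28, 47],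
    [28, 22, 27, 32, 47], [27, 22, 23, 32, 47], [33, 22, 32, 42, 43], [36, 23, 26, 34, 37],
    [29, 26, 32, 34, 37, 43], [20, 18, 19, 23, 37], [34, 18, 23, 26, 32, 37, 43],
    [37, 18, 19, 23, 26, 32, 43], [26, 18, 19, 23, 32, 43, 48], [19, 18, 23, 32, 42, 43, 48],
    [22, 23, 32, 42, 43, 47, 48], [43, 18, 23, 32, 42, 47, 48], [42, 18, 23, 32, 47, 48],
    [18, 23, 32, 47, 48], [23, 32, 47, 48], [47, 32, 48], [32, 48], [48]]

def up13 : Fin 50 → Fin 50 :=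
  ![22, 23, 21, 23, 29, 25, 27, 38, 34, 30, 19, 35, 25, 31, 24, 26, 18, 41, 19, 20, 31, 31,
    42, 34, 36, 40, 37, 44, 32, 35, 36, 32, 33, 42, 42, 38, 38, 39, 39, 40, 41, 43, 43, 44,
    45, 46, 47, 48, 49, 49]

def branch13 : Fin 50 → Fin 7 :=
  ![6, 4, 0, 3, 4, 5, 2, 0, 1, 0, 0, 6, 3, 3, 0, 1, 6, 1, 1, 3, 3, 6, 0, 6, 0, 5, 3, 6, 5, 5,
    5, 5, 5, 0, 1, 1, 4, 4, 6, 4, 0, 6, 0, 4, 2, 1, 2, 2, 2, 3]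

def step13 : Fin 50 → Fin 50 :=
  ![0, 1, 2, 3, 39, 5, 6, 33, 8, 40, 22, 38, 49, 19, 24, 35, 21, 18, 8, 3, 19, 23, 9, 27, 22,
    28, 12, 11, 30, 31, 32, 5, 31, 2, 8, 34, 1, 36, 41, 37, 7, 0, 2, 39, 6, 17, 48, 44, 47,
    3]

def level13 : Fin 50 → ℕ :=
  ![0, 0, 0, 0, 4, 0, 0, 2, 0, 4, 6, 3, 2, 2, 7, 3, 7, 2, 1, 1, 2, 6, 5, 5, 6, 5, 3, 4, 4, 2,
    3, 1, 2, 1, 1, 2, 1, 2, 2, 3, 3, 1, 1, 4, 1, 3, 4, 2, 3, 1]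

def root13 : Fin 7 → Fin 50 :=
  ![2, 8, 6, 3, 1, 5, 0]

lemma par1_lt : ∀ i, i ≠ Fin.last 33 → i < par1 i := by decide +kernel

/-- The tree `T1`. -/
def tree1 : PhyloTree (Fin 34) (Fin 18) :=
  mkTree par1 par1_lt (by decide +kernel) (by decide +kernel)

lemma par2_lt : ∀ i, i ≠ Fin.last 33 → i < par2 i := by decide +kernel

/-- The tree `T2`. -/
def tree2 : PhyloTree (Fin 34) (Fin 18) :=
  mkTree par2 par2_lt (by decide +kernel) (by decide +kernel)

lemma par3_lt : ∀ i, i ≠ Fin.last 33 → i < par3 i := by decide +kernel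

/-- The tree `T3`. -/
def tree3 : PhyloTree (Fin 34) (Fin 18) :=
  mkTree par3 par3_lt (by decide +kernel) (by decide +kernel)

lemma tw12 : treewidth (model par1 par2) = 3 :=
  treewidth_model par1_lt par2_lt own12 bag12 up12 branch12 step12 level12 root12
    (by decide +kernel) (by decide +kernel) (by decide +kernel) (by decide +kernel)
    (by decide +kernel) (by decide +kernel) (by decide +kernel) (by decide +kernel)

lemma dtw12 : dtw tree1 tree2 = 1 := by
  have h := treewidth_iso (modelIso par1 par2)
  rw [tw12] at h
  change treewidth (displayGraph (V1 := Fin 34) (V2 := Fin 34) (parGraph (n := 33) par1) leafMap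
    (parGraph (n := 33) par2) leafMap) - 2 = 1
  rw [← h]

lemma tw23 : treewidth (model par2 par3) = 4 :=
  treewidth_model par2_lt par3_lt own23 bag23 up23 branch23 step23 level23 root23
    (by decide +kernel) (by decide +kernel) (by decide +kernel) (by decide +kernel)
    (by decide +kernel) (by decide +kernel) (by decide +kernel) (by decide +kernel)

lemma dtw23 : dtw tree2 tree3 = 2 := by
  have h := treewidth_iso (modelIso par2 par3)
  rw [tw23] at h
  change treewidth (displayGraph (V1 := Fin 34) (V2 := Fin 34) (parGraph (n := 33) par2) leafMap
    (parGraph (n := 33) par3) leafMap) - 2 = 2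
  rw [← h]

lemma tw13 : treewidth (model par1 par3) = 6 :=
  treewidth_model par1_lt par3_lt own13 bag13 up13 branch13 step13 level13 root13
    (by decide +kernel) (by decide +kernel) (by decide +kernel) (by decide +kernel)
    (by decide +kernel) (by decide +kernel) (by decide +kernel) (by decide +kernel)

lemma dtw13 : dtw tree1 tree3 = 4 := by
  have h := treewidth_iso (modelIso par1 par3)
  rw [tw13] at h
  change treewidth (displayGraph (V1 := Fin 34) (V2 := Fin 34) (parGraph (n := 33) par1) leafMap
    (parGraph (n := 33) par3) leafMap) - 2 = 4
  rw [← h]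

/-- The treewidth distance violates the triangle inequality: there are three
unrooted binary phylogenetic trees `T1, T2, T3` on a common label set `X` with
`|X| ≥ 3` such that `d_tw(T1,T2) = 1`, `d_tw(T2,T3) = 2`, `d_tw(T1,T3) = 4` and
hence `d_tw(T1,T3) > d_tw(T1,T2) + d_tw(T2,T3)`. -/
theorem dtw_not_triangle_inequality :
    ∃ (X V1 V2 V3 : Type) (T1 : PhyloTree V1 X) (T2 : PhyloTree V2 X)
      (T3 : PhyloTree V3 X),
      3 ≤ Nat.card X ∧
      dtw T1 T2 = 1 ∧ dtw T2 T3 = 2 ∧ dtw T1 T3 = 4 ∧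
      dtw T1 T2 + dtw T2 T3 < dtw T1 T3 := by
  refine ⟨Fin 18, Fin 34, Fin 34, Fin 34, tree1, tree2, tree3, ?_, dtw12, dtw23, dtw13, ?_⟩
  · simp
  · rw [dtw12, dtw23, dtw13]
    norm_num
end

section
/- Suppose T1 and T2 are a pair of incompatible unrooted binary phylogenetic trees on X and the pair (T1',T2') is obtained from (T1,T2) by one application of the Common Pendant Subtree reduction. Then d_tw(T1,T2) = d_tw(T1',T2'). -/
open SimpleGraph

/-- The pendant subtree of `T` detached by deleting the edge `{a, b}`: the set of
vertices reachable from `b` after deleting that edge. -/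
def PendantSet {V X : Type*} (T : PhyloTree V X) (a b : V) : Set V :=
  {v | (T.graph.deleteEdges {s(a, b)}).Reachable b v}

/-- `XT` is the taxon set of a common pendant subtree of `T1` and `T2`, detached
by deleting the edge `{a1, b1}` of `T1` and `{a2, b2}` of `T2` (with `b1`, `b2`
the endpoints closest to the subtree), the two rooted pendant subtrees being
identical via a label-preserving root-preserving isomorphism. -/
def CommonPendant {V1 V2 X : Type*} (T1 : PhyloTree V1 X) (T2 : PhyloTree V2 X)
    (a1 b1 : V1) (a2 b2 : V2) (XT : Set X) : Prop :=
  T1.graph.Adj a1 b1 ∧ T2.graph.Adj a2 b2 ∧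
  (∀ x : X, x ∈ XT ↔ T1.leaf x ∈ PendantSet T1 a1 b1) ∧
  (∀ x : X, x ∈ XT ↔ T2.leaf x ∈ PendantSet T2 a2 b2) ∧
  ∃ φ : V1 → V2,
    Set.InjOn φ (PendantSet T1 a1 b1) ∧
    φ '' (PendantSet T1 a1 b1) = PendantSet T2 a2 b2 ∧
    φ b1 = b2 ∧
    (∀ x ∈ XT, φ (T1.leaf x) = T2.leaf x) ∧
    (∀ u ∈ PendantSet T1 a1 b1, ∀ v ∈ PendantSet T1 a1 b1,
      (T1.graph.Adj u v ↔ T2.graph.Adj (φ u) (φ v)))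

/-- `T'` is the tree obtained from `T` by clipping off the pendant subtree with
vertex set `S` (detached at `b1`, the endpoint of a deleted edge closest to the
subtree) and placing the single new taxon `none` (labelling `b1`) in its place;
the taxa outside the clipped subtree keep their labels. -/
def IsClipTree {V X W : Type*} (T : PhyloTree V X) (b1 : V) (S : Set V) (XT : Set X)
    (T' : PhyloTree W (Option {x : X // x ∉ XT})) : Prop :=
  ∃ φ : W → V,
    Function.Injective φ ∧
    Set.range φ = Sᶜ ∪ {b1} ∧
    φ (T'.leaf none) = b1 ∧
    (∀ x : {x : X // x ∉ XT}, φ (T'.leaf (some x)) = T.leaf x.1) ∧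
    (∀ w w' : W, T'.graph.Adj w w' ↔ T.graph.Adj (φ w) (φ w'))

lemma rtg_lift {α β : Type*} {r : α → α → Prop} {s : β → β → Prop} (f : α → β)
    (h : ∀ a b, r a b → s (f a) (f b)) {a b : α} (hab : Relation.ReflTransGen r a b) :
    Relation.ReflTransGen s (f a) (f b) := by
  induction hab with
  | refl => exact .refl
  | tail _ hbc ih => exact .tail ih (h _ _ hbc)

/-- Connectedness of a set of vertices inside a graph, phrased with chains. -/
def ConnIn {V : Type*} (G : SimpleGraph V) (B : Set V) : Prop :=
  ∀ u ∈ B, ∀ v ∈ B, Relation.ReflTransGen (fun a b => G.Adj a b ∧ a ∈ B ∧ b ∈ B) u v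

lemma connIn_of_preconnected {V : Type*} {G : SimpleGraph V} {B : Set V}
    (h : (G.induce B).Preconnected) : ConnIn G B := by
  intro u hu v hv
  have h1 := (reachable_iff_reflTransGen _ _).1 (h ⟨u, hu⟩ ⟨v, hv⟩)
  exact rtg_lift (fun a : B => a.1) (fun a b hab => ⟨hab, a.2, b.2⟩) h1

lemma preconnected_of_connIn {V : Type*} {G : SimpleGraph V} {B : Set V}
    (h : ConnIn G B) : (G.induce B).Preconnected := by
  rintro ⟨u, hu⟩ ⟨v, hv⟩
  have h1 := h u hu v hv
  suffices H : ∀ w, Relation.ReflTransGen (fun a b => G.Adj a b ∧ a ∈ B ∧ b ∈ B) u w →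
      ∀ hw : w ∈ B, (G.induce B).Reachable ⟨u, hu⟩ ⟨w, hw⟩ from H v h1 hv
  intro w hw
  induction hw with
  | refl => intro _; exact Reachable.refl _
  | tail _ hbc ih =>
    intro hw
    exact (ih hbc.2.1).trans (Adj.reachable (by simpa using hbc.1))

lemma rtg_mono_set {V : Type*} {G : SimpleGraph V} {B C : Set V} (hBC : B ⊆ C) {u v : V}
    (h : Relation.ReflTransGen (fun a b => G.Adj a b ∧ a ∈ B ∧ b ∈ B) u v) :
    Relation.ReflTransGen (fun a b => G.Adj a b ∧ a ∈ C ∧ b ∈ C) u v :=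
  rtg_lift id (fun _ _ h => ⟨h.1, hBC h.2.1, hBC h.2.2⟩) h

lemma rtg_symm {V : Type*} {G : SimpleGraph V} {B : Set V} {u v : V}
    (h : Relation.ReflTransGen (fun a b => G.Adj a b ∧ a ∈ B ∧ b ∈ B) u v) :
    Relation.ReflTransGen (fun a b => G.Adj a b ∧ a ∈ B ∧ b ∈ B) v u := by
  induction h with
  | refl => exact .refl
  | tail _ hbc ih => exact .head ⟨hbc.1.symm, hbc.2.2, hbc.2.1⟩ ih

lemma connIn_of_center {V : Type*} {G : SimpleGraph V} {B : Set V} {c : V}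
    (h : ∀ v ∈ B, Relation.ReflTransGen (fun a b => G.Adj a b ∧ a ∈ B ∧ b ∈ B) c v) :
    ConnIn G B := fun u hu v hv => (rtg_symm (h u hu)).trans (h v hv)

/-- Partial tree decompositions: bags inside `U`, covering all pairs related by `R`. -/
def PTD {V : Type*} (U : Set V) (R : V → V → Prop) (k : ℕ) : Prop :=
  ∃ (n : ℕ) (t : SimpleGraph (Fin (n + 1))) (bag : Fin (n + 1) → Finset V),
    t.IsTree ∧
    (∀ i, ∀ v ∈ bag i, v ∈ U) ∧
    (∀ v ∈ U, ∃ i, v ∈ bag i) ∧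
    (∀ u v : V, R u v → ∃ i, u ∈ bag i ∧ v ∈ bag i) ∧
    (∀ v : V, ConnIn t {i | v ∈ bag i}) ∧
    (∀ i, (bag i).card ≤ k + 1)

lemma hasTD_of_ptd {V : Type*} {G : SimpleGraph V} {U : Set V} {R : V → V → Prop} {k : ℕ}
    (h : PTD U R k) (hU : ∀ v, v ∈ U) (hR : ∀ u v, G.Adj u v → R u v) :
    HasTreeDecompWidthLE G k := by
  obtain ⟨n, t, bag, ht, h0, h1, h2, h3, h4⟩ := h
  refine ⟨n, t, bag, ht, fun v => h1 v (hU v), fun u v huv => h2 u v (hR u v huv), ?_, h4⟩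
  intro v
  obtain ⟨i, hi⟩ := h1 v (hU v)
  exact { preconnected := preconnected_of_connIn (h3 v), nonempty := ⟨⟨i, hi⟩⟩ }

lemma hasTD_mono {V : Type*} {G : SimpleGraph V} {k l : ℕ} (hkl : k ≤ l)
    (h : HasTreeDecompWidthLE G k) : HasTreeDecompWidthLE G l := by
  obtain ⟨n, t, bag, h1, h2, h3, h4, h5⟩ := h
  exact ⟨n, t, bag, h1, h2, h3, h4, fun i => (h5 i).trans (by omega)⟩

/-- Attach a new leaf `none` to the node `i`. -/
def attachLeaf {ι : Type*} (t : SimpleGraph ι) (i : ι) : SimpleGraph (Option ι) :=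
  t.map Function.Embedding.some ⊔ edge none (some i)

lemma attachLeaf_tree {ι : Type*} {t : SimpleGraph ι} (ht : t.IsTree) (i : ι) :
    (attachLeaf t i).IsTree := by
  have hsome : ∀ j, (attachLeaf t i).Reachable (some i) (some j) := by
    intro j
    have h1 := (ht.connected.preconnected i j)
    have h2 := h1.map (SimpleGraph.Embedding.map Function.Embedding.some t).toHom
    exact h2.mono le_sup_left
  have hedge : (attachLeaf t i).Adj (some i) none := by
    simp [attachLeaf, edge_adj]
  refine ⟨?_, ?_⟩
  · rw [connected_iff_exists_forall_reachable]
    refine ⟨some i, ?_⟩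
    rintro (_ | j)
    · exact hedge.reachable
    · exact hsome j
  · apply IsAcyclic.sup_edge_of_not_reachable
    · rintro ⟨w⟩
      cases w with
      | cons h _ => obtain ⟨_, a, b, _, h, _⟩ := h; simp at h
    · rw [isAcyclic_iff_forall_adj_isBridge]
      rintro v w hvw
      obtain ⟨_, a, b, hab, rfl, rfl⟩ := hvw
      have := isAcyclic_iff_forall_adj_isBridge.1 ht.isAcyclic hab
      rw [isBridge_iff] at this ⊢
      intro hr
      apply this
      rw [reachable_iff_reflTransGen] at hr
      suffices H : ∀ z, Relation.ReflTransGen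
          ((t.map Function.Embedding.some).deleteEdges {s(some a, some b)}).Adj (some a) z →
          ∃ c, z = some c ∧ (t.deleteEdges {s(a, b)}).Reachable a c by
        obtain ⟨c, hc, hc'⟩ := H _ hr
        simp at hc
        subst hc
        exact hc'
      intro z hz
      induction hz with
      | refl => exact ⟨a, rfl, Reachable.refl _⟩
      | tail _ hbc ih =>
        obtain ⟨c, rfl, hc⟩ := ih
        rw [deleteEdges_adj] at hbc
        obtain ⟨⟨_, x, y, hxy, hx, rfl⟩, hne⟩ := hbc
        simp at hx
        subst hx
        refine ⟨y, rfl, hc.trans (Adj.reachable ?_)⟩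
        rw [deleteEdges_adj]
        refine ⟨hxy, ?_⟩
        intro h
        apply hne
        simp only [Set.mem_singleton_iff, Sym2.eq_iff] at h ⊢
        simpa using h

lemma ptd_of_type {V ι : Type*} [Finite ι] [Nonempty ι] {U : Set V} {R : V → V → Prop} {k : ℕ}
    (t : SimpleGraph ι) (bag : ι → Finset V) (ht : t.IsTree)
    (h0 : ∀ i, ∀ v ∈ bag i, v ∈ U)
    (h1 : ∀ v ∈ U, ∃ i, v ∈ bag i)
    (h2 : ∀ u v : V, R u v → ∃ i, u ∈ bag i ∧ v ∈ bag i)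
    (h3 : ∀ v : V, ConnIn t {i | v ∈ bag i})
    (h4 : ∀ i, (bag i).card ≤ k + 1) : PTD U R k := by
  obtain ⟨m, ⟨e⟩⟩ := Finite.exists_equiv_fin ι
  obtain ⟨n, rfl⟩ : ∃ n, m = n + 1 := by
    cases m with
    | zero => exact (e (Classical.arbitrary ι)).elim0
    | succ n => exact ⟨n, rfl⟩
  refine ⟨n, t.comap e.symm, fun i => bag (e.symm i), ?_, ?_, ?_, ?_, ?_, ?_⟩
  · exact (Iso.isTree_iff (SimpleGraph.Iso.comap e.symm t)).2 ht
  · exact fun i v hv => h0 _ v hv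
  · intro v hv
    obtain ⟨i, hi⟩ := h1 v hv
    exact ⟨e i, by simpa using hi⟩
  · intro u v huv
    obtain ⟨i, hi⟩ := h2 u v huv
    exact ⟨e i, by simpa using hi⟩
  · intro v x hx y hy
    have := rtg_lift e
      (s := fun a b => (t.comap e.symm).Adj a b ∧ a ∈ {i | v ∈ bag (e.symm i)} ∧
        b ∈ {i | v ∈ bag (e.symm i)}) (fun a b hab => by simpa using hab) (h3 v _ hx _ hy)
    simpa using this
  · exact fun i => h4 _

lemma ptd_extend {V : Type*} {U : Set V} {R : V → V → Prop} {k : ℕ} (hk : 2 ≤ k)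
    (h : PTD U R k) {p q v : V} (hpq : R p q) (hv : v ∉ U) :
    PTD (insert v U)
      (fun a b => R a b ∨ ((a = p ∨ a = q ∨ a = v) ∧ (b = p ∨ b = q ∨ b = v))) k := by
  classical
  obtain ⟨n, t, bag, ht, h0, h1, h2, h3, h4⟩ := h
  obtain ⟨i, hpi, hqi⟩ := h2 p q hpq
  let bag' : Option (Fin (n + 1)) → Finset V := fun o => o.elim {p, q, v} bag
  have hlift : ∀ (w : V) (x y : Fin (n + 1)), w ∈ bag x → w ∈ bag y →
      Relation.ReflTransGen (fun a b => (attachLeaf t i).Adj a b ∧ a ∈ {o | w ∈ bag' o} ∧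
        b ∈ {o | w ∈ bag' o}) (some x) (some y) := by
    intro w x y hx hy
    refine rtg_lift some ?_ (h3 w x hx y hy)
    rintro a b ⟨hab, ha, hb⟩
    refine ⟨?_, ha, hb⟩
    exact Or.inl ⟨by simpa using hab.ne, a, b, hab, rfl, rfl⟩
  have hedge : (attachLeaf t i).Adj (some i) none := by
    simp [attachLeaf, edge_adj]
  have hp := h0 i p hpi
  have hq := h0 i q hqi
  refine ptd_of_type (attachLeaf t i) bag' (attachLeaf_tree ht i) ?_ ?_ ?_ ?_ ?_
  · rintro (_ | j) w hw
    · simp only [bag', Option.elim, Finset.mem_insert, Finset.mem_singleton] at hw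
      rcases hw with rfl | rfl | rfl
      · exact Or.inr hp
      · exact Or.inr hq
      · exact Or.inl rfl
    · exact Or.inr (h0 j w hw)
  · rintro w (rfl | hw)
    · exact ⟨none, by simp [bag']⟩
    · obtain ⟨j, hj⟩ := h1 w hw
      exact ⟨some j, hj⟩
  · rintro a b (hab | ⟨ha, hb⟩)
    · obtain ⟨j, hj⟩ := h2 a b hab
      exact ⟨some j, hj⟩
    · exact ⟨none, by simpa [bag'] using ha, by simpa [bag'] using hb⟩
  · intro w
    by_cases hwv : w = v
    · subst hwv
      refine connIn_of_center (c := none) ?_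
      rintro (_ | j) hj
      · exact .refl
      · exact absurd (h0 j w hj) hv
    · by_cases hwn : w ∈ bag' none
      · have hwi : w ∈ bag i := by
          simp only [bag', Option.elim, Finset.mem_insert, Finset.mem_singleton] at hwn
          rcases hwn with rfl | rfl | rfl
          · exact hpi
          · exact hqi
          · exact absurd rfl hwv
        refine connIn_of_center (c := some i) ?_
        rintro (_ | j) hj
        · exact .single ⟨hedge, hwi, hwn⟩
        · exact hlift w i j hwi hj
      · rintro (_ | x) hx
        · exact absurd hx hwn
        · rintro (_ | y) hy
          · exact absurd hy hwn
          · exact hlift w x y hx hy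
  · rintro (_ | j)
    · exact (Finset.card_le_three).trans (by omega)
    · exact h4 j

lemma ptd_congr {V : Type*} {U U' : Set V} {R R' : V → V → Prop} {k : ℕ}
    (h : PTD U R k) (hU : U = U') (hR : ∀ a b, R' a b → R a b) : PTD U' R' k := by
  subst hU
  obtain ⟨n, t, bag, ht, h0, h1, h2, h3, h4⟩ := h
  exact ⟨n, t, bag, ht, h0, h1, fun u v huv => h2 u v (hR u v huv), h3, h4⟩

lemma acyclic_unique_nbr {A : Type*} {T : SimpleGraph A} (hT : T.IsAcyclic) {P : Set A}
    (hP : ConnIn T P) {c p p' : A} (hc : c ∉ P) (hp : p ∈ P) (hp' : p' ∈ P)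
    (h : T.Adj c p) (h' : T.Adj c p') : p = p' := by
  by_contra hne
  have hb := isAcyclic_iff_forall_adj_isBridge.1 hT h
  rw [isBridge_iff] at hb
  apply hb
  have h1 : (T.deleteEdges {s(c, p)}).Adj c p' := by
    rw [deleteEdges_adj]
    refine ⟨h', ?_⟩
    simp only [Set.mem_singleton_iff, Sym2.eq_iff]
    rintro (⟨_, h⟩ | ⟨h, _⟩)
    · exact hne h.symm
    · exact hc (h ▸ hp)
  refine h1.reachable.trans ?_
  rw [reachable_iff_reflTransGen]
  refine rtg_lift id ?_ (hP p' hp' p hp)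
  rintro a b ⟨hab, ha, hb⟩
  rw [deleteEdges_adj]
  refine ⟨hab, ?_⟩
  simp only [Set.mem_singleton_iff, Sym2.eq_iff]
  rintro (⟨h, _⟩ | ⟨_, h⟩)
  · exact hc (h ▸ ha)
  · exact hc (h ▸ hb)

lemma exists_exit {A : Type*} {T : SimpleGraph A} {S P : Set A} {b s : A} (hb : b ∈ P)
    (hs : s ∉ P) (h : Relation.ReflTransGen (fun a b => T.Adj a b ∧ a ∈ S ∧ b ∈ S) b s) :
    ∃ p ∈ P, ∃ c ∈ S, c ∉ P ∧ T.Adj p c := by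
  induction h with
  | refl => exact absurd hb hs
  | @tail x y _ hbc ih =>
    by_cases hx : x ∈ P
    · exact ⟨x, hx, y, hbc.2.2, hs, hbc.1⟩
    · exact ih hx

lemma ptd_grow {A V : Type*} {T : SimpleGraph A} (hT : T.IsAcyclic) {S : Set A}
    (hSf : S.Finite) (hS : ConnIn T S) {b : A} (hbS : b ∈ S) (α β : A → V)
    (hα : Set.InjOn α S) (hβ : Set.InjOn β S)
    (hαβ : ∀ u ∈ S, ∀ v ∈ S, α u = β v → u = v)
    {U0 : Set V} (hα0 : ∀ u ∈ S, u ≠ b → α u ∉ U0) (hβ0 : ∀ u ∈ S, u ≠ b → β u ∉ U0)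
    {k : ℕ} (hk : 2 ≤ k) {R0 : V → V → Prop} :
    ∀ (m : ℕ) (P : Set A) (R : V → V → Prop), (S \ P).ncard = m → P ⊆ S → b ∈ P → ConnIn T P →
      PTD (U0 ∪ α '' P ∪ β '' P) R k → (∀ x y, R0 x y → R x y) →
      (∀ u ∈ P, R (α u) (β u)) →
      (∀ u ∈ P, ∀ v ∈ P, T.Adj u v → (R (α u) (α v) ∧ R (β u) (β v))) →
      ∃ R' : V → V → Prop, PTD (U0 ∪ α '' S ∪ β '' S) R' k ∧ (∀ x y, R0 x y → R' x y) ∧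
        (∀ u ∈ S, ∀ v ∈ S, T.Adj u v → (R' (α u) (α v) ∧ R' (β u) (β v))) := by
  intro m
  induction m with
  | zero =>
    intro P R hm hPS _ _ hptd hR0 _ hadj
    have : S \ P = ∅ := (Set.ncard_eq_zero (hSf.subset Set.sdiff_subset)).1 hm
    have hSP : P = S := hPS.antisymm (Set.sdiff_eq_empty.1 this)
    subst hSP
    exact ⟨R, hptd, hR0, hadj⟩
  | succ m ih =>
    intro P R hm hPS hbP hP hptd hR0 hdiag hadj
    have hne : (S \ P).Nonempty := by
      rw [← Set.ncard_pos (hSf.subset Set.sdiff_subset)]; omega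
    obtain ⟨s, hsS, hsP⟩ := hne
    obtain ⟨p, hp, c, hcS, hcP, hpc⟩ := exists_exit hbP hsP (hS b hbS s hsS)
    have hcb : c ≠ b := fun h => hcP (h ▸ hbP)
    have hUα : α c ∉ U0 ∪ α '' P ∪ β '' P := by
      rintro ((h | ⟨u, hu, h⟩) | ⟨u, hu, h⟩)
      · exact hα0 c hcS hcb h
      · exact hcP (hα (hPS hu) hcS h ▸ hu)
      · exact hcP (hαβ c hcS u (hPS hu) h.symm ▸ hu)
    have hUβ : β c ∉ U0 ∪ α '' P ∪ β '' P := by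
      rintro ((h | ⟨u, hu, h⟩) | ⟨u, hu, h⟩)
      · exact hβ0 c hcS hcb h
      · exact hcP (hαβ u (hPS hu) c hcS h ▸ hu)
      · exact hcP (hβ (hPS hu) hcS h ▸ hu)
    have hmem : (S \ insert c P).ncard = m := by
      have h1 : S \ insert c P = (S \ P) \ {c} := by
        ext x; simp only [Set.mem_sdiff, Set.mem_insert_iff, Set.mem_singleton_iff]; tauto
      rw [h1, Set.ncard_sdiff_singleton_of_mem (show c ∈ S \ P from ⟨hcS, hcP⟩), hm]
      rfl
    have hconn : ConnIn T (insert c P) := by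
      refine connIn_of_center (c := p) ?_
      rintro x (rfl | hx)
      · exact .single ⟨hpc, Or.inr hp, Or.inl rfl⟩
      · exact rtg_mono_set (Set.subset_insert _ _) (hP p hp x hx)
    have huniq : ∀ u ∈ P, T.Adj c u → u = p := fun u hu hcu =>
      acyclic_unique_nbr hT hP hcP hu hp hcu hpc.symm
    have hadjs : ∀ R' : V → V → Prop, (∀ x y, R x y → R' x y) →
        R' (α c) (α p) → R' (α p) (α c) → R' (β c) (β p) → R' (β p) (β c) →
        ∀ u ∈ insert c P, ∀ v ∈ insert c P, T.Adj u v →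
          (R' (α u) (α v) ∧ R' (β u) (β v)) := by
      intro R' hRR h1 h2 h3 h4 u hu v hv huv
      rcases hu with rfl | hu
      · rcases hv with rfl | hv
        · exact absurd rfl huv.ne
        · obtain rfl := huniq v hv huv
          exact ⟨h1, h3⟩
      · rcases hv with rfl | hv
        · obtain rfl := huniq u hu huv.symm
          exact ⟨h2, h4⟩
        · exact ⟨hRR _ _ (hadj u hu v hv huv).1, hRR _ _ (hadj u hu v hv huv).2⟩
    have e1 := ptd_extend hk hptd (hdiag p hp) hUα
    by_cases hcc : β c = α c
    · refine ih (insert c P) _ hmem (Set.insert_subset hcS hPS) (Or.inr hbP) hconn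
        (ptd_congr e1 ?_ (fun _ _ h => h)) ?_ ?_ ?_
      · rw [Set.image_insert_eq, Set.image_insert_eq, hcc]
        ext x; simp only [Set.mem_union, Set.mem_insert_iff]; tauto
      · exact fun x y h => Or.inl (hR0 x y h)
      · rintro u (rfl | hu)
        · right; simp [hcc]
        · exact Or.inl (hdiag u hu)
      · refine hadjs (fun a b => R a b ∨ ((a = α p ∨ a = β p ∨ a = α c) ∧ (b = α p ∨ b = β p ∨ b = α c))) ?_ ?_ ?_ ?_ ?_
        · exact fun x y h => Or.inl h
        all_goals (right; simp [hcc])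
    · have e2 := ptd_extend hk e1 (p := α c) (q := β p) (v := β c) (by right; simp) (by
        rintro (h | h)
        · exact hcc h
        · exact hUβ h)
      refine ih (insert c P) _ hmem (Set.insert_subset hcS hPS) (Or.inr hbP) hconn
        (ptd_congr e2 ?_ (fun _ _ h => h)) ?_ ?_ ?_
      · rw [Set.image_insert_eq, Set.image_insert_eq]
        ext x; simp only [Set.mem_union, Set.mem_insert_iff]; tauto
      · exact fun x y h => Or.inl (Or.inl (hR0 x y h))
      · rintro u (rfl | hu)
        · right; simp
        · exact Or.inl (Or.inl (hdiag u hu))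
      · refine hadjs (fun a b => (R a b ∨ ((a = α p ∨ a = β p ∨ a = α c) ∧ (b = α p ∨ b = β p ∨ b = α c))) ∨
          ((a = α c ∨ a = β p ∨ a = β c) ∧ (b = α c ∨ b = β p ∨ b = β c))) ?_ ?_ ?_ ?_ ?_
        · exact fun x y h => Or.inl (Or.inl h)
        · left; right; simp
        · left; right; simp
        · right; simp
        · right; simp

/-- Minor monotonicity. -/
lemma hasTD_minor {V W : Type*} {G : SimpleGraph V} {H : SimpleGraph W} [Finite W] {k : ℕ}
    (B : W → Set V) (hne : ∀ w, (B w).Nonempty) (hconn : ∀ w, ConnIn G (B w))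
    (hdisj : ∀ w w' v, v ∈ B w → v ∈ B w' → w = w')
    (hadj : ∀ w w', H.Adj w w' → ∃ u ∈ B w, ∃ v ∈ B w', G.Adj u v)
    (h : HasTreeDecompWidthLE G k) : HasTreeDecompWidthLE H k := by
  classical
  obtain ⟨n, t, bag, ht, h1, h2, h3, h4⟩ := h
  have := Fintype.ofFinite W
  let bag' : Fin (n + 1) → Finset W := fun i => Finset.univ.filter (fun w => ∃ v ∈ B w, v ∈ bag i)
  have hb : ∀ i w, w ∈ bag' i ↔ ∃ v ∈ B w, v ∈ bag i := by intro i w; simp [bag']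
  refine ⟨n, t, bag', ht, ?_, ?_, ?_, ?_⟩
  · intro w
    obtain ⟨v, hv⟩ := hne w
    obtain ⟨i, hi⟩ := h1 v
    exact ⟨i, (hb i w).2 ⟨v, hv, hi⟩⟩
  · intro w w' hww
    obtain ⟨u, hu, v, hv, huv⟩ := hadj w w' hww
    obtain ⟨i, hi, hi'⟩ := h2 u v huv
    exact ⟨i, (hb i w).2 ⟨u, hu, hi⟩, (hb i w').2 ⟨v, hv, hi'⟩⟩
  · intro w
    have hsub : ∀ v ∈ B w, {i | v ∈ bag i} ⊆ {i | w ∈ bag' i} :=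
      fun v hv i hi => (hb i w).2 ⟨v, hv, hi⟩
    obtain ⟨v, hv⟩ := hne w
    obtain ⟨i, hi⟩ := h1 v
    refine { preconnected := preconnected_of_connIn ?_, nonempty := ⟨⟨i, hsub v hv hi⟩⟩ }
    refine connIn_of_center (c := i) ?_
    intro j hj
    obtain ⟨u, hu, hju⟩ := (hb j w).1 hj
    have hr := hconn w v hv u hu
    clear hj
    induction hr generalizing j with
    | refl => exact rtg_mono_set (hsub v hv) (connIn_of_preconnected (h3 v).preconnected i hi j hju)
    | @tail x y _ hxy ih =>
      obtain ⟨l, hl, hl'⟩ := h2 x y hxy.1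
      refine (ih l hxy.2.1 hl).trans ?_
      exact rtg_mono_set (hsub y hxy.2.2)
        (connIn_of_preconnected (h3 y).preconnected l hl' j hju)
  · intro i
    refine le_trans ?_ (h4 i)
    have hch : ∀ w, ∃ v, w ∈ bag' i → v ∈ B w ∧ v ∈ bag i := by
      intro w
      by_cases hw : w ∈ bag' i
      · obtain ⟨v, hv⟩ := (hb i w).1 hw
        exact ⟨v, fun _ => hv⟩
      · exact ⟨(hne w).some, fun h => absurd h hw⟩
    choose f hf using hch
    refine Finset.card_le_card_of_injOn f (fun w hw => (hf w hw).2) ?_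
    intro w hw w' hw' hww
    exact hdisj w w' (f w) (hf w hw).1 (hww ▸ (hf w' hw').1)

section Display

variable {V1 V2 X : Type*} {l1 : X → V1} {l2 : X → V2}

lemma disp_inl_inj {u v : V1}
    (h : toDisplay l1 l2 (Sum.inl u) = toDisplay l1 l2 (Sum.inl v)) : u = v := by
  have := congrArg Subtype.val h
  simpa [toDisplay, mergeMap] using this

lemma mergeMap_leaf (h2 : Function.Injective l2) (x : X) :
    mergeMap l1 l2 (Sum.inr (l2 x)) = Sum.inl (l1 x) := by
  have h : ∃ y, l2 y = l2 x := ⟨x, rfl⟩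
  have h' : h.choose = x := h2 h.choose_spec
  simp only [mergeMap, h, dif_pos]
  rw [h']

lemma mergeMap_nonleaf {v : V2} (h : ∀ x, l2 x ≠ v) :
    mergeMap l1 l2 (Sum.inr v) = Sum.inr v := by
  have h' : ¬ ∃ y, l2 y = v := fun ⟨x, hx⟩ => h x hx
  simp only [mergeMap, h', dif_neg, not_false_eq_true]

lemma disp_leaf (h2 : Function.Injective l2) (x : X) :
    toDisplay l1 l2 (Sum.inr (l2 x)) = toDisplay l1 l2 (Sum.inl (l1 x)) :=
  Subtype.ext (mergeMap_leaf h2 x)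

lemma disp_inl_inr (h2 : Function.Injective l2) {u : V1} {v : V2}
    (h : toDisplay l1 l2 (Sum.inl u) = toDisplay l1 l2 (Sum.inr v)) :
    ∃ x, u = l1 x ∧ v = l2 x := by
  by_cases hv : ∃ x, l2 x = v
  · obtain ⟨x, rfl⟩ := hv
    rw [disp_leaf h2] at h
    exact ⟨x, disp_inl_inj h, rfl⟩
  · have h1 := congrArg Subtype.val h
    have h3 : mergeMap l1 l2 (Sum.inr v) = Sum.inr v :=
      mergeMap_nonleaf (fun x hx => hv ⟨x, hx⟩)
    change Sum.inl u = mergeMap l1 l2 (Sum.inr v) at h1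
    rw [h3] at h1
    cases h1

lemma disp_inr_inj (h1 : Function.Injective l1) (h2 : Function.Injective l2) {u v : V2}
    (h : toDisplay l1 l2 (Sum.inr u) = toDisplay l1 l2 (Sum.inr v)) : u = v := by
  by_cases hu : ∃ x, l2 x = u
  · obtain ⟨x, rfl⟩ := hu
    rw [disp_leaf h2] at h
    obtain ⟨y, hy, rfl⟩ := disp_inl_inr h2 h
    rw [h1 hy]
  by_cases hv : ∃ x, l2 x = v
  · obtain ⟨x, rfl⟩ := hv
    rw [disp_leaf h2] at h
    obtain ⟨y, hy, rfl⟩ := disp_inl_inr h2 h.symm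
    rw [h1 hy]
  have h3 := congrArg Subtype.val h
  change mergeMap l1 l2 (Sum.inr u) = mergeMap l1 l2 (Sum.inr v) at h3
  rw [mergeMap_nonleaf (fun x hx => hv ⟨x, hx⟩), mergeMap_nonleaf (fun x hx => hu ⟨x, hx⟩)] at h3
  simpa using h3

lemma disp_cases (d : DisplayVertex l1 l2) :
    (∃ u, d = toDisplay l1 l2 (Sum.inl u)) ∨
      (∃ v, d = toDisplay l1 l2 (Sum.inr v) ∧ ∀ x, l2 x ≠ v) := by
  obtain ⟨(u | v), hd⟩ := d
  · exact Or.inl ⟨u, rfl⟩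
  · refine Or.inr ⟨v, Subtype.ext hd.symm, ?_⟩
    intro x hx
    have h : ∃ y, l2 y = v := ⟨x, hx⟩
    simp [mergeMap, h] at hd

lemma disp_adj {G1 : SimpleGraph V1} {G2 : SimpleGraph V2} (h1 : Function.Injective l1)
    (h2 : Function.Injective l2) (a b : DisplayVertex l1 l2) :
    (displayGraph G1 l1 G2 l2).Adj a b ↔
    ((∃ u v : V1, G1.Adj u v ∧ a = toDisplay l1 l2 (Sum.inl u) ∧
        b = toDisplay l1 l2 (Sum.inl v)) ∨
      (∃ u v : V2, G2.Adj u v ∧ a = toDisplay l1 l2 (Sum.inr u) ∧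
        b = toDisplay l1 l2 (Sum.inr v))) := by
  rw [displayGraph, SimpleGraph.fromRel_adj]
  constructor
  · rintro ⟨_, h | ⟨u, v, huv, ha, hb⟩ | ⟨u, v, huv, ha, hb⟩⟩
    · exact h
    · exact Or.inl ⟨v, u, huv.symm, hb, ha⟩
    · exact Or.inr ⟨v, u, huv.symm, hb, ha⟩
  · intro h
    refine ⟨?_, Or.inl h⟩
    rcases h with ⟨u, v, huv, rfl, rfl⟩ | ⟨u, v, huv, rfl, rfl⟩
    · exact fun h => huv.ne (disp_inl_inj h)
    · exact fun h => huv.ne (disp_inr_inj h1 h2 h)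

end Display

section Pendant

variable {V X : Type*} (T : PhyloTree V X) {a b : V}

lemma pendant_root : b ∈ PendantSet T a b := Reachable.refl _

lemma pendant_not_mem (h : T.graph.Adj a b) : a ∉ PendantSet T a b := by
  intro ha
  have hb := isAcyclic_iff_forall_adj_isBridge.1 T.acyclic h
  rw [isBridge_iff] at hb
  exact hb (Reachable.symm ha)

lemma pendant_conn : ConnIn T.graph (PendantSet T a b) := by
  refine connIn_of_center (c := b) ?_
  intro v hv
  have h := (reachable_iff_reflTransGen _ _).1 hv
  clear hv
  induction h with
  | refl => exact .refl
  | tail hbx hxy ih =>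
    have hx := (reachable_iff_reflTransGen _ _).2 hbx
    refine .tail ih ⟨(deleteEdges_le _) hxy, hx, hx.trans hxy.reachable⟩

lemma pendant_boundary (h : T.graph.Adj a b) {u v : V} (huv : T.graph.Adj u v)
    (hu : u ∈ PendantSet T a b) (hv : v ∉ PendantSet T a b) : u = b ∧ v = a := by
  have h1 : ¬ (T.graph.deleteEdges {s(a, b)}).Adj u v := fun h' =>
    hv (Reachable.trans hu h'.reachable)
  rw [deleteEdges_adj] at h1
  have h2 : s(u, v) = s(a, b) := by
    by_contra hne
    exact h1 ⟨huv, hne⟩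
  rw [Sym2.eq_iff] at h2
  rcases h2 with ⟨rfl, rfl⟩ | h2
  · exact absurd hu (pendant_not_mem T h)
  · exact h2

end Pendant

lemma ptd_of_hasTD {V W : Type*} {H : SimpleGraph W} {k : ℕ} (g : W → V)
    (hg : Function.Injective g) (h : HasTreeDecompWidthLE H k) :
    PTD (Set.range g) (fun a b => ∃ d d', (H.Adj d d' ∨ d = d') ∧ a = g d ∧ b = g d') k := by
  classical
  obtain ⟨n, t, bag, ht, h1, h2, h3, h4⟩ := h
  refine ⟨n, t, fun i => (bag i).map ⟨g, hg⟩, ht, ?_, ?_, ?_, ?_, ?_⟩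
  · intro i v hv
    obtain ⟨w, _, rfl⟩ := Finset.mem_map.1 hv
    exact ⟨w, rfl⟩
  · rintro _ ⟨w, rfl⟩
    obtain ⟨i, hi⟩ := h1 w
    exact ⟨i, Finset.mem_map_of_mem _ hi⟩
  · rintro _ _ ⟨d, d', hd, rfl, rfl⟩
    rcases hd with hd | rfl
    · obtain ⟨i, hi, hi'⟩ := h2 d d' hd
      exact ⟨i, Finset.mem_map_of_mem _ hi, Finset.mem_map_of_mem _ hi'⟩
    · obtain ⟨i, hi⟩ := h1 d
      exact ⟨i, Finset.mem_map_of_mem _ hi, Finset.mem_map_of_mem _ hi⟩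
  · intro v
    by_cases hv : ∃ w, g w = v
    · obtain ⟨w, rfl⟩ := hv
      have : {i | g w ∈ (bag i).map ⟨g, hg⟩} = {i | w ∈ bag i} := by
        ext i
        simp only [Set.mem_setOf_eq, Finset.mem_map, Function.Embedding.coeFn_mk]
        constructor
        · rintro ⟨w', hw', h⟩
          exact hg h ▸ hw'
        · exact fun hw => ⟨w, hw, rfl⟩
      rw [this]
      exact connIn_of_preconnected (h3 w).preconnected
    · intro i hi
      obtain ⟨w, _, hw⟩ := Finset.mem_map.1 hi
      exact absurd ⟨w, hw⟩ hv
  · intro i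
    rw [Finset.card_map]
    exact h4 i

lemma sub_two_eq {p q : ℕ → Prop} (hp : ∀ k l, k ≤ l → p k → p l)
    (hq : ∀ k l, k ≤ l → q k → q l) (h : ∀ k, 2 ≤ k → (p k ↔ q k)) :
    sInf {k | p k} - 2 = sInf {k | q k} - 2 := by
  have key : ∀ p q : ℕ → Prop, (∀ k l, k ≤ l → p k → p l) → (∀ k l, k ≤ l → q k → q l) →
      (∀ k, 2 ≤ k → (p k ↔ q k)) → sInf {k | p k} - 2 ≤ sInf {k | q k} - 2 := by
    intro p q hp hq h
    by_cases hne : {k | q k}.Nonempty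
    · have h1 : q (sInf {k | q k}) := Nat.sInf_mem hne
      have h2 : q (max 2 (sInf {k | q k})) := hq _ _ (le_max_right _ _) h1
      have h3 := (h _ (le_max_left _ _)).2 h2
      have h4 : sInf {k | p k} ≤ max 2 (sInf {k | q k}) := Nat.sInf_le h3
      omega
    · have hpe : {k | p k} = ∅ := by
        rw [Set.eq_empty_iff_forall_notMem]
        intro k hk
        exact hne ⟨max 2 k, (h _ (le_max_left _ _)).1 (hp _ _ (le_max_right _ _) hk)⟩
      simp [hpe]
  exact le_antisymm (key p q hp hq h) (key q p hq hp (fun k hk => (h k hk).symm))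

/-- The Common Pendant Subtree reduction preserves the treewidth distance:
if `(T1', T2')` is obtained from a pair `(T1, T2)` of incompatible unrooted
binary phylogenetic trees by clipping a maximal common pendant subtree with at
least two taxa and replacing it by a single new taxon, then
`d_tw(T1,T2) = d_tw(T1',T2')`. -/
theorem dtw_cps_reduction {V1 V2 X W1 W2 : Type*}
    (T1 : PhyloTree V1 X) (T2 : PhyloTree V2 X)
    (hinc : ¬ Compatible T1 T2)
    (a1 b1 : V1) (a2 b2 : V2) (XT : Set X)
    (hcp : CommonPendant T1 T2 a1 b1 a2 b2 XT)
    (hcard : 2 ≤ XT.ncard)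
    (hmax : ∀ Y : Set X,
      (∃ (a1' b1' : V1) (a2' b2' : V2), CommonPendant T1 T2 a1' b1' a2' b2' Y) →
      XT ⊆ Y → Y = XT)
    (T1' : PhyloTree W1 (Option {x : X // x ∉ XT}))
    (T2' : PhyloTree W2 (Option {x : X // x ∉ XT}))
    (h1 : IsClipTree T1 b1 (PendantSet T1 a1 b1) XT T1')
    (h2 : IsClipTree T2 b2 (PendantSet T2 a2 b2) XT T2') :
    dtw T1 T2 = dtw T1' T2' := by
  classical
  obtain ⟨hab1, hab2, hXT1, hXT2, φ, hφinj, hφimg, hφb, hφl, hφadj⟩ := hcp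
  obtain ⟨φ1, hφ1, hr1, hn1, hs1, hadj1⟩ := h1
  obtain ⟨φ2, hφ2, hr2, hn2, hs2, hadj2⟩ := h2
  obtain ⟨x0, hx0⟩ : XT.Nonempty := by
    by_contra h
    rw [Set.not_nonempty_iff_eq_empty] at h
    simp [h] at hcard
  have hb1 : b1 ∈ PendantSet T1 a1 b1 := pendant_root T1
  have hb2 : b2 ∈ PendantSet T2 a2 b2 := pendant_root T2
  have ha2 : a2 ∉ PendantSet T2 a2 b2 := pendant_not_mem T2 hab2
  have hc1 : ConnIn T1.graph (PendantSet T1 a1 b1) := pendant_conn T1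
  have hc2 : ConnIn T2.graph (PendantSet T2 a2 b2) := pendant_conn T2
  have hbd1 := fun u v => @pendant_boundary _ _ T1 a1 b1 hab1 u v
  have hbd2 := fun u v => @pendant_boundary _ _ T2 a2 b2 hab2 u v
  generalize PendantSet T1 a1 b1 = S1 at *
  generalize PendantSet T2 a2 b2 = S2 at *
  set i1 : V1 → DisplayVertex T1.leaf T2.leaf := fun u => toDisplay _ _ (Sum.inl u) with hi1
  set i2 : V2 → DisplayVertex T1.leaf T2.leaf := fun u => toDisplay _ _ (Sum.inr u) with hi2
  set j1 : W1 → DisplayVertex T1'.leaf T2'.leaf := fun u => toDisplay _ _ (Sum.inl u) with hj1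
  set j2 : W2 → DisplayVertex T1'.leaf T2'.leaf := fun u => toDisplay _ _ (Sum.inr u) with hj2
  have i1inj : ∀ u v, i1 u = i1 v → u = v := fun u v h => disp_inl_inj h
  have i2inj : ∀ u v, i2 u = i2 v → u = v := fun u v h =>
    disp_inr_inj T1.leaf_inj T2.leaf_inj h
  have i12 : ∀ u v, i1 u = i2 v → ∃ x, u = T1.leaf x ∧ v = T2.leaf x := fun u v h =>
    disp_inl_inr T2.leaf_inj h
  have ileaf : ∀ x, i2 (T2.leaf x) = i1 (T1.leaf x) := fun x => disp_leaf T2.leaf_inj x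
  have jleaf : ∀ x, j2 (T2'.leaf x) = j1 (T1'.leaf x) := fun x => disp_leaf T2'.leaf_inj x
  have icases : ∀ d, (∃ u, d = i1 u) ∨ ∃ v, d = i2 v ∧ ∀ x, T2.leaf x ≠ v := disp_cases
  have jcases : ∀ d, (∃ u, d = j1 u) ∨ ∃ v, d = j2 v ∧ ∀ x, T2'.leaf x ≠ v := disp_cases
  have iadj : ∀ a b, (displayGraph T1.graph T1.leaf T2.graph T2.leaf).Adj a b ↔
      ((∃ u v, T1.graph.Adj u v ∧ a = i1 u ∧ b = i1 v) ∨
        (∃ u v, T2.graph.Adj u v ∧ a = i2 u ∧ b = i2 v)) := disp_adj T1.leaf_inj T2.leaf_inj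
  have jadj : ∀ a b, (displayGraph T1'.graph T1'.leaf T2'.graph T2'.leaf).Adj a b ↔
      ((∃ u v, T1'.graph.Adj u v ∧ a = j1 u ∧ b = j1 v) ∨
        (∃ u v, T2'.graph.Adj u v ∧ a = j2 u ∧ b = j2 v)) := disp_adj T1'.leaf_inj T2'.leaf_inj
  obtain ⟨g, hg1, hg2⟩ : ∃ g : DisplayVertex T1'.leaf T2'.leaf → DisplayVertex T1.leaf T2.leaf,
      (∀ w, g (j1 w) = i1 (φ1 w)) ∧ (∀ w, w ≠ T2'.leaf none → g (j2 w) = i2 (φ2 w)) := by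
    let g : DisplayVertex T1'.leaf T2'.leaf → DisplayVertex T1.leaf T2.leaf :=
      fun d => Sum.elim (fun w => i1 (φ1 w)) (fun w => i2 (φ2 w)) d.1
    have hgj1 : ∀ w, g (j1 w) = i1 (φ1 w) := fun w => rfl
    refine ⟨g, hgj1, ?_⟩
    intro w hw
    by_cases hl : ∃ x, T2'.leaf x = w
    · obtain ⟨x, rfl⟩ := hl
      rcases x with _ | x
      · exact absurd rfl hw
      · rw [jleaf, hgj1, hs1, hs2, ileaf]
    · have hm := mergeMap_nonleaf (l1 := T1'.leaf) (fun x hx => hl ⟨x, hx⟩)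
      change Sum.elim (fun w => i1 (φ1 w)) (fun w => i2 (φ2 w))
        (mergeMap T1'.leaf T2'.leaf (Sum.inr w)) = _
      rw [hm]
      rfl
  clear_value i1 i2 j1 j2
  have hin1 : ∀ w, φ1 w ∈ S1 → w = T1'.leaf none := by
    intro w hw
    have : φ1 w ∈ S1ᶜ ∪ {b1} := hr1 ▸ ⟨w, rfl⟩
    rcases this with h | h
    · exact absurd hw h
    · exact hφ1 (h.trans hn1.symm)
  have hin2 : ∀ w, φ2 w ∈ S2 → w = T2'.leaf none := by
    intro w hw
    have : φ2 w ∈ S2ᶜ ∪ {b2} := hr2 ▸ ⟨w, rfl⟩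
    rcases this with h | h
    · exact absurd hw h
    · exact hφ2 (h.trans hn2.symm)
  have hout1 : ∀ u, u ∉ S1 ∨ u = b1 → ∃ w, φ1 w = u := by
    intro u hu
    have : u ∈ S1ᶜ ∪ {b1} := hu
    rw [← hr1] at this
    exact this
  have hout2 : ∀ u, u ∉ S2 ∨ u = b2 → ∃ w, φ2 w = u := by
    intro u hu
    have : u ∈ S2ᶜ ∪ {b2} := hu
    rw [← hr2] at this
    exact this
  have hgx : g (j1 (T1'.leaf none)) = i1 b1 := by rw [hg1, hn1]
  have hgS1 : ∀ d u, u ∈ S1 → g d = i1 u → d = j1 (T1'.leaf none) := by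
    intro d u hu hd
    rcases jcases d with ⟨w, rfl⟩ | ⟨w, rfl, hw⟩
    · rw [hg1] at hd
      have := i1inj _ _ hd
      rw [hin1 w (this ▸ hu)]
    · rw [hg2 w (fun h => hw _ h.symm)] at hd
      obtain ⟨y, rfl, hy⟩ := i12 _ _ hd.symm
      have := (hXT2 y).1 ((hXT1 y).2 hu)
      exact absurd (hin2 w (hy ▸ this)).symm (hw _)
  have hgS2 : ∀ d v, v ∈ S2 → g d = i2 v → d = j1 (T1'.leaf none) := by
    intro d v hv hd
    rcases jcases d with ⟨w, rfl⟩ | ⟨w, rfl, hw⟩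
    · rw [hg1] at hd
      obtain ⟨y, hy, rfl⟩ := i12 _ _ hd
      have := (hXT1 y).1 ((hXT2 y).2 hv)
      rw [hin1 w (hy ▸ this)]
    · rw [hg2 w (fun h => hw _ h.symm)] at hd
      have := i2inj _ _ hd
      exact absurd (hin2 w (this ▸ hv)).symm (hw _)
  have hgmix : ∀ w w', (∀ x, T2'.leaf x ≠ w') → i1 (φ1 w) = i2 (φ2 w') → False := by
    intro w w' hw' h
    obtain ⟨y, _, hy⟩ := i12 _ _ h
    by_cases hyX : y ∈ XT
    · exact hw' _ (hin2 w' (hy ▸ (hXT2 y).1 hyX)).symm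
    · have := hs2 ⟨y, hyX⟩
      exact hw' _ (hφ2 (this.trans hy.symm))
  have hginj : Function.Injective g := by
    intro d d' hdd
    rcases jcases d with ⟨w, rfl⟩ | ⟨w, rfl, hw⟩ <;>
      rcases jcases d' with ⟨w', rfl⟩ | ⟨w', rfl, hw'⟩
    · rw [hg1, hg1] at hdd
      rw [hφ1 (i1inj _ _ hdd)]
    · rw [hg1, hg2 w' (fun h => hw' _ h.symm)] at hdd
      exact (hgmix _ _ hw' hdd).elim
    · rw [hg1, hg2 w (fun h => hw _ h.symm)] at hdd
      exact (hgmix _ _ hw hdd.symm).elim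
    · rw [hg2 w (fun h => hw _ h.symm), hg2 w' (fun h => hw' _ h.symm)] at hdd
      rw [hφ2 (i2inj _ _ hdd)]
  have hfinW1 := T1'.finite
  have hfinW2 := T2'.finite
  have hfinV1 := T1.finite
  have hfinD : Finite (DisplayVertex T1'.leaf T2'.leaf) := by
    unfold DisplayVertex
    infer_instance
  unfold dtw treewidth
  refine sub_two_eq (fun k l hkl h => hasTD_mono hkl h) (fun k l hkl h => hasTD_mono hkl h) ?_
  intro k hk
  constructor
  · -- the reduced display graph is a minor
    let B : DisplayVertex T1'.leaf T2'.leaf → Set (DisplayVertex T1.leaf T2.leaf) :=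
      fun d => if d = j1 (T1'.leaf none) then i1 '' S1 ∪ i2 '' S2 else {g d}
    have hBx : B (j1 (T1'.leaf none)) = i1 '' S1 ∪ i2 '' S2 := by simp [B]
    have hBn : ∀ d, d ≠ j1 (T1'.leaf none) → B d = {g d} := by
      intro d hd; simp [B, hd]
    have hgB : ∀ d, g d ∈ B d := by
      intro d
      by_cases hd : d = j1 (T1'.leaf none)
      · subst hd
        rw [hBx, hgx]
        exact Or.inl ⟨b1, hb1, rfl⟩
      · rw [hBn d hd]; rfl
    have hgsep : ∀ d, d ≠ j1 (T1'.leaf none) → g d ∉ i1 '' S1 ∪ i2 '' S2 := by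
      rintro d hd (⟨u, hu, h⟩ | ⟨u, hu, h⟩)
      · exact hd (hgS1 d u hu h.symm)
      · exact hd (hgS2 d u hu h.symm)
    have hB1 : ∀ w, i1 (φ1 w) ∈ B (j1 w) := fun w => hg1 w ▸ hgB _
    have hB2 : ∀ w, i2 (φ2 w) ∈ B (j2 w) := by
      intro w
      by_cases hw : w = T2'.leaf none
      · subst hw
        rw [jleaf, hBx, hn2]
        exact Or.inr ⟨b2, hb2, rfl⟩
      · exact hg2 w hw ▸ hgB _
    refine hasTD_minor B (fun d => ⟨g d, hgB d⟩) ?_ ?_ ?_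
    · intro d
      by_cases hd : d = j1 (T1'.leaf none)
      · subst hd
        rw [hBx]
        refine connIn_of_center (c := i1 (T1.leaf x0)) ?_
        rintro v (⟨u, hu, rfl⟩ | ⟨u, hu, rfl⟩)
        · refine rtg_lift i1 ?_ (hc1 _ ((hXT1 x0).1 hx0) u hu)
          rintro p q ⟨hpq, hp, hq⟩
          exact ⟨(iadj _ _).2 (Or.inl ⟨p, q, hpq, rfl, rfl⟩), Or.inl ⟨p, hp, rfl⟩,
            Or.inl ⟨q, hq, rfl⟩⟩
        · rw [← ileaf]
          refine rtg_lift i2 ?_ (hc2 _ ((hXT2 x0).1 hx0) u hu)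
          rintro p q ⟨hpq, hp, hq⟩
          exact ⟨(iadj _ _).2 (Or.inr ⟨p, q, hpq, rfl, rfl⟩), Or.inr ⟨p, hp, rfl⟩,
            Or.inr ⟨q, hq, rfl⟩⟩
      · rw [hBn d hd]
        rintro u rfl v rfl
        exact .refl
    · intro d d' v hv hv'
      by_cases hd : d = j1 (T1'.leaf none) <;> by_cases hd' : d' = j1 (T1'.leaf none)
      · rw [hd, hd']
      · rw [hBn d' hd'] at hv'
        rw [hd, hBx] at hv
        obtain rfl := hv'
        exact absurd hv (hgsep d' hd')
      · rw [hBn d hd] at hv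
        rw [hd', hBx] at hv'
        obtain rfl := hv
        exact absurd hv' (hgsep d hd)
      · rw [hBn d hd] at hv
        rw [hBn d' hd'] at hv'
        obtain rfl := hv
        exact hginj hv'
    · intro d d' hdd
      rcases (jadj _ _).1 hdd with ⟨u, v, huv, rfl, rfl⟩ | ⟨u, v, huv, rfl, rfl⟩
      · exact ⟨_, hB1 u, _, hB1 v, (iadj _ _).2 (Or.inl ⟨_, _, (hadj1 u v).1 huv, rfl, rfl⟩)⟩
      · exact ⟨_, hB2 u, _, hB2 v, (iadj _ _).2 (Or.inr ⟨_, _, (hadj2 u v).1 huv, rfl, rfl⟩)⟩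
  · intro hTD
    have hP0 := ptd_of_hasTD g hginj hTD
    obtain ⟨R0, hR0⟩ : ∃ R0 : DisplayVertex T1.leaf T2.leaf → DisplayVertex T1.leaf T2.leaf → Prop,
      R0 = (fun a b => ∃ d d', ((displayGraph T1'.graph T1'.leaf T2'.graph T2'.leaf).Adj d d' ∨
        d = d') ∧ a = g d ∧ b = g d') := ⟨_, rfl⟩
    rw [← hR0] at hP0
    have hR0g : ∀ d d', (displayGraph T1'.graph T1'.leaf T2'.graph T2'.leaf).Adj d d' →
        R0 (g d) (g d') := by
      intro d d' h
      rw [hR0]; exact ⟨d, d', Or.inl h, rfl, rfl⟩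
    have hR0refl : ∀ d, R0 (g d) (g d) := by
      intro d
      rw [hR0]; exact ⟨d, d, Or.inr rfl, rfl, rfl⟩
    clear hR0
    obtain ⟨a2', ha2'⟩ := hout2 a2 (Or.inl ha2)
    have ha2n : a2' ≠ T2'.leaf none := by
      rintro rfl
      rw [hn2] at ha2'
      exact ha2 (ha2' ▸ hb2)
    have hga2 : g (j2 a2') = i2 a2 := by rw [hg2 _ ha2n, ha2']
    have hadjx : (displayGraph T1'.graph T1'.leaf T2'.graph T2'.leaf).Adj
        (j1 (T1'.leaf none)) (j2 a2') := by
      rw [jadj]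
      refine Or.inr ⟨T2'.leaf none, a2', ?_, (jleaf none).symm, rfl⟩
      rw [hadj2, hn2, ha2']
      exact hab2.symm
    have hRx1 : R0 (i1 b1) (i2 a2) := by
      have := hR0g _ _ hadjx
      rwa [hgx, hga2] at this
    have hRx2 : R0 (i2 a2) (i1 b1) := by
      have := hR0g _ _ hadjx.symm
      rwa [hgx, hga2] at this
    obtain ⟨R1, hP1, hR01, hd1, he1, he2⟩ :
        ∃ R1 : DisplayVertex T1.leaf T2.leaf → DisplayVertex T1.leaf T2.leaf → Prop,
          PTD (Set.range g ∪ {i1 b1} ∪ {i2 b2}) R1 k ∧ (∀ x y, R0 x y → R1 x y) ∧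
          R1 (i1 b1) (i2 b2) ∧ R1 (i2 b2) (i2 a2) ∧ R1 (i2 a2) (i2 b2) := by
      by_cases hbb : i2 b2 = i1 b1
      · refine ⟨R0, ptd_congr hP0 ?_ (fun _ _ h => h), fun _ _ h => h, ?_, ?_, ?_⟩
        · have : i1 b1 ∈ Set.range g := ⟨_, hgx⟩
          rw [hbb]
          ext y
          simp only [Set.mem_union, Set.mem_singleton_iff]
          constructor
          · tauto
          · rintro ((h | rfl) | rfl) <;> assumption
        · rw [hbb, ← hgx]
          exact hR0refl _
        · rw [hbb]; exact hRx1
        · rw [hbb]; exact hRx2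
      · have hnot : i2 b2 ∉ Set.range g := by
          rintro ⟨d, hd⟩
          have := hgS2 d b2 hb2 hd
          rw [this, hgx] at hd
          exact hbb hd.symm
        refine ⟨_, ptd_congr (ptd_extend hk hP0 hRx1 hnot) ?_ (fun _ _ h => h),
          fun _ _ h => Or.inl h, ?_, ?_, ?_⟩
        · have : i1 b1 ∈ Set.range g := ⟨_, hgx⟩
          ext y
          simp only [Set.mem_union, Set.mem_singleton_iff, Set.mem_insert_iff]
          constructor
          · tauto
          · rintro ((h | rfl) | rfl) <;> tauto
        all_goals (right; simp)
    have hφS2 : ∀ u ∈ S1, φ u ∈ S2 := fun u hu => hφimg ▸ ⟨u, hu, rfl⟩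
    have hαβ : ∀ u ∈ S1, ∀ v ∈ S1, i1 u = i2 (φ v) → u = v := by
      intro u hu v hv h
      obtain ⟨y, rfl, hy⟩ := i12 _ _ h
      have := hφl y ((hXT1 y).2 hu)
      exact hφinj hu hv (this.trans hy.symm)
    obtain ⟨R', hP', hR0', hadj'⟩ := ptd_grow T1.acyclic (S := S1) (Set.toFinite _) hc1 hb1 i1
      (fun u => i2 (φ u)) (fun u _ v _ h => i1inj u v h)
      (fun u hu v hv h => hφinj hu hv (i2inj _ _ h)) hαβ (U0 := Set.range g)
      (by
        rintro u hu hub ⟨d, hd⟩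
        have := hgS1 d u hu hd
        rw [this, hgx] at hd
        exact hub (i1inj _ _ hd).symm)
      (by
        rintro u hu hub ⟨d, hd⟩
        have := hgS2 d _ (hφS2 u hu) hd
        rw [this, hgx] at hd
        exact hub (hαβ b1 hb1 u hu hd).symm)
      hk (R0 := R1) _ {b1} R1 rfl (by simpa using hb1) rfl
      (by rintro u rfl v rfl; exact .refl)
      (by simpa [hφb] using hP1) (fun _ _ h => h)
      (by rintro u rfl; rw [hφb]; exact hd1)
      (by rintro u rfl v rfl h; exact absurd rfl h.ne)
    refine hasTD_of_ptd hP' ?_ ?_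
    · intro d
      have h1 : ∀ u, i1 u ∈ Set.range g ∪ i1 '' S1 ∪ (fun u => i2 (φ u)) '' S1 := by
        intro u
        by_cases hu : u ∈ S1
        · exact Or.inl (Or.inr ⟨u, hu, rfl⟩)
        · obtain ⟨w, rfl⟩ := hout1 u (Or.inl hu)
          exact Or.inl (Or.inl ⟨_, hg1 w⟩)
      rcases icases d with ⟨u, rfl⟩ | ⟨v, rfl, _⟩
      · exact h1 u
      · by_cases hv : v ∈ S2
        · rw [← hφimg] at hv
          obtain ⟨u, hu, rfl⟩ := hv
          exact Or.inr ⟨u, hu, rfl⟩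
        · obtain ⟨w, rfl⟩ := hout2 v (Or.inl hv)
          refine Or.inl (Or.inl ⟨_, hg2 w ?_⟩)
          rintro rfl
          exact hv (hn2 ▸ hb2)
    · intro d d' hdd
      have hR0'' : ∀ x y, R0 x y → R' x y := fun x y h => hR0' x y (hR01 x y h)
      rcases (iadj _ _).1 hdd with ⟨u, v, huv, rfl, rfl⟩ | ⟨u, v, huv, rfl, rfl⟩
      · have hfar : (u ∉ S1 ∨ u = b1) → (v ∉ S1 ∨ v = b1) → R' (i1 u) (i1 v) := by
          intro hu hv
          obtain ⟨w, rfl⟩ := hout1 u hu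
          obtain ⟨w', rfl⟩ := hout1 v hv
          rw [← hg1, ← hg1]
          exact hR0'' _ _ (hR0g _ _ ((jadj _ _).2 (Or.inl ⟨w, w', (hadj1 _ _).2 huv, rfl, rfl⟩)))
        by_cases hu : u ∈ S1 <;> by_cases hv : v ∈ S1
        · exact (hadj' u hu v hv huv).1
        · exact hfar (Or.inr (hbd1 u v huv hu hv).1) (Or.inl hv)
        · exact hfar (Or.inl hu) (Or.inr (hbd1 v u huv.symm hv hu).1)
        · exact hfar (Or.inl hu) (Or.inl hv)
      · by_cases hu : u ∈ S2 <;> by_cases hv : v ∈ S2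
        · rw [← hφimg] at hu hv
          obtain ⟨p, hp, rfl⟩ := hu
          obtain ⟨q, hq, rfl⟩ := hv
          exact (hadj' p hp q hq ((hφadj p hp q hq).2 huv)).2
        · obtain ⟨rfl, rfl⟩ := hbd2 u v huv hu hv
          exact hR0' _ _ he1
        · obtain ⟨rfl, rfl⟩ := hbd2 v u huv.symm hv hu
          exact hR0' _ _ he2
        · obtain ⟨w, rfl⟩ := hout2 u (Or.inl hu)
          obtain ⟨w', rfl⟩ := hout2 v (Or.inl hv)
          have hw : w ≠ T2'.leaf none := by rintro rfl; exact hu (hn2 ▸ hb2)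
          have hw' : w' ≠ T2'.leaf none := by rintro rfl; exact hv (hn2 ▸ hb2)
          rw [← hg2 w hw, ← hg2 w' hw']
          exact hR0'' _ _ (hR0g _ _ ((jadj _ _).2 (Or.inr ⟨w, w', (hadj2 _ _).2 huv, rfl, rfl⟩)))
end
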